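/- arXiv:1909.05822 — 11 statements merged into one kernel-verified Lean document; each statement's English description precedes it below -/
import Mathlib

section
/- Let n ∈ ℕ, let I ⊆ {1,…,n} be nonempty, let b ∈ {0,1}, and let f_I : {0,1}^n → {0,1} be the parity function f_I(x) = (Σ_{i∈I} x_i + b) mod 2. Then for every probability distribution D on {0,1}^n and every ρ ≥ 1, the constant-in-the-ball robust risk of f_I with respect to itself satisfies R^C_ρ(f_I, f_I) = 1. -/
open MeasureTheory ENNReal Filter

/-- Exact-in-the-ball robust risk `R^E_ρ(h,c)` on the Boolean hypercube. -/
noncomputable def RE (N ρ : ℕ) (μ : Measure (Fin N → Bool))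
    (h c : (Fin N → Bool) → Bool) : ℝ≥0∞ :=
  μ {x | ∃ z : Fin N → Bool, hammingDist x z ≤ ρ ∧ h z ≠ c z}

/-- Constant-in-the-ball robust risk `R^C_ρ(h,c)` on the Boolean hypercube. -/
noncomputable def RC (N ρ : ℕ) (μ : Measure (Fin N → Bool))
    (h c : (Fin N → Bool) → Bool) : ℝ≥0∞ :=
  μ {x | ∃ z : Fin N → Bool, hammingDist x z ≤ ρ ∧ h z ≠ c x}

/-- Label a sample `S` with target concept `c`. -/
def labelWith (n : ℕ) (c : (Fin n → Bool) → Bool) {m : ℕ}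
    (S : Fin m → (Fin n → Bool)) : Fin m → (Fin n → Bool) × Bool :=
  fun i => (S i, c (S i))

/-- Expected exact-in-the-ball robust risk of learner `A` on an i.i.d. `m`-sample. -/
noncomputable def expRisk (n m ρ : ℕ) (μ : Measure (Fin n → Bool))
    (A : (Fin m → (Fin n → Bool) × Bool) → ((Fin n → Bool) → Bool))
    (c : (Fin n → Bool) → Bool) : ℝ≥0∞ :=
  ∫⁻ S, RE n ρ μ (A (labelWith n c S)) c ∂(Measure.pi fun _ : Fin m => μ)

/-- Monotone conjunction with index set `I`. -/
def monConj (n : ℕ) (I : Finset (Fin n)) : (Fin n → Bool) → Bool :=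
  fun x => decide (∀ i ∈ I, x i = true)

/-- Uniform distribution on the Boolean hypercube. -/
noncomputable def unif (n : ℕ) : Measure (Fin n → Bool) :=
  (PMF.uniformOfFintype (Fin n → Bool)).toMeasure

/-- `μ` is `α`-log-Lipschitz: every point has positive mass and the log of the
mass function is `log α`-Lipschitz w.r.t. Hamming distance. -/
def logLipschitz (n : ℕ) (α : ℝ) (μ : Measure (Fin n → Bool)) : Prop :=
  (∀ x : Fin n → Bool, 0 < μ {x}) ∧
  ∀ x x' : Fin n → Bool, hammingDist x x' = 1 →
    |Real.log (μ {x}).toReal - Real.log (μ {x'}).toReal| ≤ Real.log α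

/-- The parity function `f_I(x) = (Σ_{i∈I} x_i + b) mod 2`. -/
def parity (n : ℕ) (I : Finset (Fin n)) (b : ℕ) : (Fin n → Bool) → Bool :=
  fun x => decide (((∑ i ∈ I, cond (x i) 1 0) + b) % 2 = 1)

/-- Flipping one coordinate of the index set flips the parity. -/
theorem parity_update_not_ne {n : ℕ} {I : Finset (Fin n)} {i : Fin n} (hi : i ∈ I) (b : ℕ)
    (x : Fin n → Bool) :
    parity n I b (Function.update x i (!x i)) ≠ parity n I b x := by
  have hrest : ∑ j ∈ I.erase i, cond (Function.update x i (!x i) j) 1 0 =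
      ∑ j ∈ I.erase i, cond (x j) 1 0 :=
    Finset.sum_congr rfl fun j hj => by
      rw [Function.update_of_ne (Finset.ne_of_mem_erase hj)]
  unfold parity
  rw [← Finset.add_sum_erase I _ hi, ← Finset.add_sum_erase I (fun j => cond (x j) 1 0) hi,
    hrest, Function.update_self, ne_eq, decide_eq_decide]
  cases x i <;> simp only [Bool.not_true, Bool.not_false, cond_true, cond_false] <;> omega

/-- Changing one coordinate moves a point by Hamming distance at most one. -/
theorem hammingDist_update_le_one {ι : Type*} [Fintype ι] [DecidableEq ι] {β : ι → Type*}
    [∀ i, DecidableEq (β i)] (x : ∀ i, β i) (i : ι) (a : β i) :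
    hammingDist x (Function.update x i a) ≤ 1 := by
  refine (Finset.card_le_card (t := {i}) fun j hj => ?_).trans_eq (Finset.card_singleton i)
  by_contra hne
  simp [Function.update_of_ne (Finset.notMem_singleton.mp hne)] at hj

/-- for a nonempty index set, a parity function has
constant-in-the-ball robust risk `1` with respect to itself, for any
distribution and any radius `ρ ≥ 1`. -/
theorem stmt1 (n : ℕ) (I : Finset (Fin n)) (hI : I.Nonempty) (b : ℕ) (hb : b ≤ 1)
    (μ : Measure (Fin n → Bool)) [IsProbabilityMeasure μ] (ρ : ℕ) (hρ : 1 ≤ ρ) :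
    RC n ρ μ (parity n I b) (parity n I b) = 1 := by
  obtain ⟨i, hi⟩ := hI
  have huniv : {x | ∃ z : Fin n → Bool, hammingDist x z ≤ ρ ∧
      parity n I b z ≠ parity n I b x} = Set.univ :=
    Set.eq_univ_of_forall fun x => ⟨Function.update x i (!x i),
      (hammingDist_update_le_one x i _).trans hρ, parity_update_not_ne hi b x⟩
  rw [RC, huniv, measure_univ]
end

section
/- Let n ≥ 2 and let c₁(x) = x₁ and c₂(x) = x₂ be the dictator functions on the first two coordinates of {0,1}^n. Let D be the distribution on {0,1}^n under which x₁ is uniform on {0,1}, x₂ = x₁ with probability 1, and the coordinates x₃,…,x_n are independent and uniform on {0,1}. Then for every m ∈ ℕ and every learning algorithm A mapping labeled m-samples to hypotheses h : {0,1}^n → {0,1}, (1/2)·E_{S∼D^m}[R^E_1(A(S_{c₁}), c₁)] + (1/2)·E_{S∼D^m}[R^E_1(A(S_{c₂}), c₂)] ≥ 1/2; in particular there exists c ∈ {c₁,c₂} with E_{S∼D^m}[R^E_1(A(S_c), c)] ≥ 1/2. -/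
open MeasureTheory ENNReal Filter

/-- If two targets agree almost surely while almost every point has, within distance `ρ`, a point
where they differ, then the expected robust risks of any learner against them add up to at least
one: the learner cannot tell the targets apart from its sample. -/
theorem one_le_expRisk_add_expRisk (n m ρ : ℕ) (μ : Measure (Fin n → Bool))
    [IsProbabilityMeasure μ] (A : (Fin m → (Fin n → Bool) × Bool) → ((Fin n → Bool) → Bool))
    (c₁ c₂ : (Fin n → Bool) → Bool) (hc : ∀ᵐ x ∂μ, c₁ x = c₂ x)
    (hball : ∀ᵐ x ∂μ, ∃ z, hammingDist x z ≤ ρ ∧ c₁ z ≠ c₂ z) :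
    1 ≤ expRisk n m ρ μ A c₁ + expRisk n m ρ μ A c₂ := by
  have hlabel : ∀ᵐ S ∂(Measure.pi fun _ : Fin m => μ),
      labelWith n c₁ S = labelWith n c₂ S := by
    rw [ae_iff_of_countable] at hc ⊢
    intro S hS
    rw [Measure.pi_singleton, Finset.prod_ne_zero_iff] at hS
    funext i
    simp only [labelWith, hc (S i) (hS i (Finset.mem_univ i))]
  have hrisk (h : (Fin n → Bool) → Bool) : 1 ≤ RE n ρ μ h c₁ + RE n ρ μ h c₂ := by
    refine le_trans ?_ (measure_union_le _ _)
    rw [← measure_univ (μ := μ)]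
    refine measure_mono_ae ?_
    filter_upwards [hball] with x ⟨z, hz, hne⟩ _
    by_cases h₁ : h z = c₁ z
    · exact Or.inr ⟨z, hz, h₁ ▸ hne⟩
    · exact Or.inl ⟨z, hz, h₁⟩
  unfold expRisk
  rw [← lintegral_add_left (measurable_of_countable _)]
  calc (1 : ℝ≥0∞) = ∫⁻ _, 1 ∂(Measure.pi fun _ : Fin m => μ) := by simp
    _ ≤ _ := lintegral_mono_ae (by
      filter_upwards [hlabel] with S hS
      rw [hS]
      exact hrisk _)

/-- with the distribution where `x₁ = x₂` almost surely (each
uniform) and the remaining coordinates uniform and independent, any learner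
has average robust risk at least `1/2` against the two dictator targets. -/
theorem stmt2 (n : ℕ) (hn : 2 ≤ n) (m : ℕ)
    (μ : Measure (Fin n → Bool)) [IsProbabilityMeasure μ]
    (hμ : ∀ x : Fin n → Bool,
      μ {x} = if x ⟨0, by omega⟩ = x ⟨1, by omega⟩ then (2 : ℝ≥0∞)⁻¹ ^ (n - 1) else 0)
    (A : (Fin m → (Fin n → Bool) × Bool) → ((Fin n → Bool) → Bool))
    (c₁ c₂ : (Fin n → Bool) → Bool)
    (hc₁ : c₁ = fun x => x ⟨0, by omega⟩) (hc₂ : c₂ = fun x => x ⟨1, by omega⟩) :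
    2⁻¹ * expRisk n m 1 μ A c₁ + 2⁻¹ * expRisk n m 1 μ A c₂ ≥ 2⁻¹ ∧
    (expRisk n m 1 μ A c₁ ≥ 2⁻¹ ∨ expRisk n m 1 μ A c₂ ≥ 2⁻¹) := by
  have hae : ∀ᵐ x ∂μ, x ⟨0, by omega⟩ = x ⟨1, by omega⟩ := by
    rw [ae_iff_of_countable]
    intro x hx
    by_contra hne
    exact hx (by rw [hμ x, if_neg hne])
  have hsum : 1 ≤ expRisk n m 1 μ A c₁ + expRisk n m 1 μ A c₂ := by
    subst hc₁ hc₂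
    refine one_le_expRisk_add_expRisk n m 1 μ A _ _ hae ?_
    filter_upwards [hae] with x hx
    refine ⟨Function.update x ⟨0, by omega⟩ (!x ⟨0, by omega⟩), ?_, ?_⟩
    · refine (Finset.card_le_card (t := {⟨0, by omega⟩}) fun i hi => ?_).trans_eq
        (Finset.card_singleton _)
      by_contra hne
      simp_all [Function.update_of_ne]
    · simp [Function.update_of_ne, ← hx]
  have havg : 2⁻¹ * expRisk n m 1 μ A c₁ + 2⁻¹ * expRisk n m 1 μ A c₂ ≥ 2⁻¹ := by
    rw [← mul_add]
    exact le_mul_of_one_le_right' hsum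
  refine ⟨havg, ?_⟩
  by_contra! hlt
  have hlt' := ENNReal.add_lt_add hlt.1 hlt.2
  rw [ENNReal.inv_two_add_inv_two] at hlt'
  exact hlt'.not_ge hsum
end

section
/- Let n ∈ ℕ, I ⊆ {1,…,n}, and let c₁, c₂ : {0,1}^n → {0,1} be functions that depend only on the coordinates in I (i.e., if x and y agree on all coordinates in I then c_j(x) = c_j(y) for j = 1,2). Let z ∈ {0,1}^n be such that c₁(z) = c₂(z) and there exists i ∈ I with c₁(z^{⊕i}) ≠ c₂(z^{⊕i}), where z^{⊕i} denotes z with its i-th bit flipped. Let η ∈ (0,1) and let D be the product distribution on {0,1}^n in which independently each coordinate i ∈ I equals z_i with probability 1−η, and each coordinate outside I is uniform on {0,1}. Then: (a) R^E_1(c₁,c₂) ≥ (1−η)^{|I|}; and (b) for every m ∈ ℕ, Pr_{S∼D^m}[∀ x ∈ S, c₁(x) = c₂(x)] ≥ (1−η)^{m·|I|}. -/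
open MeasureTheory ENNReal Filter

/-- `c` depends only on the coordinates in `I`. -/
def dependsOnlyOn (n : ℕ) (I : Finset (Fin n)) (c : (Fin n → Bool) → Bool) : Prop :=
  ∀ x y : Fin n → Bool, (∀ i ∈ I, x i = y i) → c x = c y

/-- The number of points of the hypercube that agree with `z` on `I`. -/
theorem card_filter_forall_mem_eq (n : ℕ) (I : Finset (Fin n)) (z : Fin n → Bool) :
    (Finset.univ.filter fun x : Fin n → Bool => ∀ i ∈ I, x i = z i).card = 2 ^ (n - I.card) := by
  have h : (Finset.univ.filter fun x : Fin n → Bool => ∀ i ∈ I, x i = z i) =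
      Fintype.piFinset fun i => if i ∈ I then {z i} else Finset.univ := by
    ext x
    simp only [Finset.mem_filter, Finset.mem_univ, true_and, Fintype.mem_piFinset]
    refine forall_congr' fun i => ?_
    by_cases hi : i ∈ I <;> simp [hi]
  have hc : ∀ i : Fin n, (if i ∈ I then ({z i} : Finset Bool) else Finset.univ).card =
      if i ∈ I then 1 else 2 := by
    intro i
    split_ifs <;> simp
  rw [h, Fintype.card_piFinset, Finset.prod_congr rfl fun i _ => hc i, Finset.prod_ite]
  simp [← Finset.compl_filter, Finset.card_compl]

/-- The subcube of points agreeing with `z` on `I` has mass `(1 - η) ^ |I|`. -/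
theorem measure_forall_mem_eq (n : ℕ) (I : Finset (Fin n)) (z : Fin n → Bool) (η : ℝ≥0∞)
    (μ : Measure (Fin n → Bool))
    (hμ : ∀ x : Fin n → Bool,
      μ {x} = (∏ i ∈ I, if x i = z i then 1 - η else η) * 2⁻¹ ^ (n - I.card)) :
    μ {x | ∀ i ∈ I, x i = z i} = (1 - η) ^ I.card := by
  have h : {x : Fin n → Bool | ∀ i ∈ I, x i = z i} =
      ((Finset.univ.filter fun x : Fin n → Bool => ∀ i ∈ I, x i = z i : Finset _) : Set _) := by
    simp
  have hx : ∀ x ∈ Finset.univ.filter (fun x : Fin n → Bool => ∀ i ∈ I, x i = z i),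
      μ {x} = (1 - η) ^ I.card * 2⁻¹ ^ (n - I.card) := by
    intro x hx
    have hxz : ∀ i ∈ I, x i = z i := by simpa using hx
    rw [hμ x, Finset.prod_congr rfl fun i hi => if_pos (hxz i hi), Finset.prod_const]
  rw [h, ← sum_measure_singleton, Finset.sum_congr rfl hx, Finset.sum_const,
    card_filter_forall_mem_eq, nsmul_eq_mul, mul_left_comm, Nat.cast_pow, ← mul_pow]
  simp [ENNReal.mul_inv_cancel]

/-- for `c₁,c₂` depending only on `I`, agreeing at `z` but
disagreeing on a one-bit flip of `z` inside `I`, under the product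
distribution concentrated near `z` on `I`:
(a) `R^E_1(c₁,c₂) ≥ (1-η)^{|I|}`, and
(b) an i.i.d. `m`-sample is consistently labeled by both with probability
`≥ (1-η)^{m|I|}`. -/
theorem stmt3 (n : ℕ) (I : Finset (Fin n)) (c₁ c₂ : (Fin n → Bool) → Bool)
    (hdep₁ : dependsOnlyOn n I c₁) (hdep₂ : dependsOnlyOn n I c₂)
    (z : Fin n → Bool) (hz : c₁ z = c₂ z)
    (hflip : ∃ i ∈ I, c₁ (Function.update z i (!z i)) ≠ c₂ (Function.update z i (!z i)))
    (η : ℝ≥0∞) (hη0 : 0 < η) (hη1 : η < 1)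
    (μ : Measure (Fin n → Bool)) [IsProbabilityMeasure μ]
    (hμ : ∀ x : Fin n → Bool,
      μ {x} = (∏ i ∈ I, if x i = z i then 1 - η else η) * 2⁻¹ ^ (n - I.card)) :
    RE n 1 μ c₁ c₂ ≥ (1 - η) ^ I.card ∧
    ∀ m : ℕ, (Measure.pi fun _ : Fin m => μ)
        {S : Fin m → (Fin n → Bool) | ∀ i, c₁ (S i) = c₂ (S i)}
      ≥ (1 - η) ^ (m * I.card) := by
  have hA := measure_forall_mem_eq n I z η μ hμ
  constructor
  · obtain ⟨i, -, hi⟩ := hflip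
    rw [ge_iff_le, ← hA]
    refine measure_mono fun x hx => ⟨Function.update x i (!z i), ?_, ?_⟩
    · refine (Finset.card_le_card (t := {i}) fun j hj => ?_).trans (Finset.card_singleton i).le
      by_contra hji
      simp_all [Function.update_of_ne]
    · have hagree : ∀ j ∈ I,
          Function.update x i (!z i) j = Function.update z i (!z i) j := by
        intro j hj
        by_cases hji : j = i
        · subst hji
          simp
        · simpa [Function.update_of_ne hji] using hx j hj
      rwa [hdep₁ _ _ hagree, hdep₂ _ _ hagree]
  · intro m
    have hS : {S : Fin m → (Fin n → Bool) | ∀ i, c₁ (S i) = c₂ (S i)} =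
        Set.pi Set.univ fun _ => {x | c₁ x = c₂ x} := by
      ext S
      simp
    rw [ge_iff_le, hS, Measure.pi_pi, Finset.prod_const, Finset.card_univ, Fintype.card_fin,
      mul_comm, pow_mul, ← hA]
    refine pow_le_pow_left' (measure_mono fun x hx => ?_) m
    simp only [Set.mem_ofPred_eq] at hx ⊢
    rw [hdep₁ x z hx, hdep₂ x z hx, hz]
end

section
/- Let n ∈ ℕ, I ⊆ {1,…,n}, and let c₁, c₂ : {0,1}^n → {0,1} depend only on the coordinates in I, with a point z ∈ {0,1}^n such that c₁(z) = c₂(z) and c₁(z^{⊕i}) ≠ c₂(z^{⊕i}) for some i ∈ I, where z^{⊕i} denotes z with its i-th bit flipped. Let η ∈ (0,1) and let D be the product distribution on {0,1}^n in which independently each coordinate i ∈ I equals z_i with probability 1−η and each coordinate outside I is uniform. Then for every m ∈ ℕ and every learning algorithm A mapping labeled m-samples to hypotheses, (1/2)·E_{S∼D^m}[R^E_1(A(S_{c₁}), c₁)] + (1/2)·E_{S∼D^m}[R^E_1(A(S_{c₂}), c₂)] ≥ (1/2)·(1−η)^{(m+1)·|I|}. -/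
open MeasureTheory ENNReal Filter

/-- The subcube of points that agree with `z` on `I`. -/
def agreeOn (n : ℕ) (I : Finset (Fin n)) (z : Fin n → Bool) : Set (Fin n → Bool) :=
  {x | ∀ i ∈ I, x i = z i}

lemma agreeOn_eq_piFinset (n : ℕ) (I : Finset (Fin n)) (z : Fin n → Bool) :
    agreeOn n I z =
      (Fintype.piFinset fun i => if i ∈ I then ({z i} : Finset Bool) else Finset.univ :
        Finset (Fin n → Bool)) := by
  ext x
  simp only [agreeOn, Set.mem_ofPred_eq, Finset.mem_coe, Fintype.mem_piFinset]
  refine forall_congr' fun i => ?_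
  split_ifs with hi <;> simp [hi]

lemma card_piFinset_agreeOn (n : ℕ) (I : Finset (Fin n)) (z : Fin n → Bool) :
    (Fintype.piFinset fun i => if i ∈ I then ({z i} : Finset Bool) else Finset.univ).card
      = 2 ^ (n - I.card) := by
  rw [Fintype.card_piFinset]
  simp only [apply_ite Finset.card, Finset.card_singleton, Finset.card_univ, Fintype.card_bool]
  rw [Finset.prod_ite]
  simp [Finset.filter_not, Finset.card_sdiff]

lemma measure_agreeOn (n : ℕ) (I : Finset (Fin n)) (z : Fin n → Bool) (η : ℝ≥0∞)
    (μ : Measure (Fin n → Bool))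
    (hμ : ∀ x : Fin n → Bool,
      μ {x} = (∏ i ∈ I, if x i = z i then 1 - η else η) * 2⁻¹ ^ (n - I.card)) :
    μ (agreeOn n I z) = (1 - η) ^ I.card := by
  have hpt : ∀ x ∈ agreeOn n I z, μ {x} = (1 - η) ^ I.card * 2⁻¹ ^ (n - I.card) := by
    intro x hx
    rw [hμ, Finset.prod_congr rfl fun i hi => if_pos (hx i hi), Finset.prod_const]
  rw [agreeOn_eq_piFinset] at hpt ⊢
  rw [← sum_measure_singleton, Finset.sum_congr rfl hpt, Finset.sum_const,
    card_piFinset_agreeOn, nsmul_eq_mul, mul_left_comm]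
  push_cast
  rw [← mul_pow, ENNReal.mul_inv_cancel (by simp) (by simp), one_pow, mul_one]

lemma hammingDist_update_le_one_s4 {n : ℕ} (x : Fin n → Bool) (i : Fin n) (b : Bool) :
    hammingDist x (Function.update x i b) ≤ 1 := by
  refine (Finset.card_le_card (t := {i}) fun j hj => ?_).trans (Finset.card_singleton i).le
  by_contra h
  simp_all [Function.update_of_ne]

/-- If `c₁` and `c₂` disagree within distance one of every point of `E`, no hypothesis is robust
for both targets on `E`. -/
lemma measure_le_RE_add_RE {n ρ : ℕ} {μ : Measure (Fin n → Bool)}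
    {c₁ c₂ : (Fin n → Bool) → Bool} {E : Set (Fin n → Bool)}
    (hE : ∀ x ∈ E, ∃ y, hammingDist x y ≤ ρ ∧ c₁ y ≠ c₂ y) (h : (Fin n → Bool) → Bool) :
    μ E ≤ RE n ρ μ h c₁ + RE n ρ μ h c₂ := by
  refine (measure_mono fun x hx => ?_).trans (measure_union_le _ _)
  obtain ⟨y, hxy, hy⟩ := hE x hx
  by_cases h₁ : h y = c₁ y
  · exact Or.inr ⟨y, hxy, h₁ ▸ hy⟩
  · exact Or.inl ⟨y, hxy, h₁⟩

/-- If `c₁` and `c₂` agree on `E` but disagree within distance `ρ` of every point of `E`, samples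
inside `E` do not distinguish them. -/
lemma measure_pow_le_expRisk_add_expRisk {n ρ : ℕ} (μ : Measure (Fin n → Bool)) [SigmaFinite μ]
    {c₁ c₂ : (Fin n → Bool) → Bool} {E : Set (Fin n → Bool)}
    (hagree : ∀ x ∈ E, c₁ x = c₂ x)
    (hE : ∀ x ∈ E, ∃ y, hammingDist x y ≤ ρ ∧ c₁ y ≠ c₂ y)
    (m : ℕ) (A : (Fin m → (Fin n → Bool) × Bool) → ((Fin n → Bool) → Bool)) :
    μ E ^ (m + 1) ≤ expRisk n m ρ μ A c₁ + expRisk n m ρ μ A c₂ := by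
  unfold expRisk
  rw [← lintegral_add_left (Measurable.of_discrete)]
  calc μ E ^ (m + 1)
      = ∫⁻ _ in Set.univ.pi fun _ : Fin m => E, μ E ∂(Measure.pi fun _ : Fin m => μ) := by
        rw [setLIntegral_const, Measure.pi_pi]
        simp [pow_succ']
    _ ≤ ∫⁻ S in Set.univ.pi fun _ : Fin m => E,
          RE n ρ μ (A (labelWith n c₁ S)) c₁ + RE n ρ μ (A (labelWith n c₂ S)) c₂
          ∂(Measure.pi fun _ : Fin m => μ) := by
        refine setLIntegral_mono .of_discrete fun S hS => ?_
        have hlabel : labelWith n c₁ S = labelWith n c₂ S :=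
          funext fun j => Prod.ext rfl (hagree _ (hS j (Set.mem_univ j)))
        rw [hlabel]
        exact measure_le_RE_add_RE hE _
    _ ≤ _ := setLIntegral_le_lintegral _ _

/-- under the same setup as Statement 3, every learner `A` has
average expected robust risk at least `(1/2)·(1-η)^{(m+1)|I|}` against the two
targets `c₁, c₂`. -/
theorem stmt4 (n : ℕ) (I : Finset (Fin n)) (c₁ c₂ : (Fin n → Bool) → Bool)
    (hdep₁ : dependsOnlyOn n I c₁) (hdep₂ : dependsOnlyOn n I c₂)
    (z : Fin n → Bool) (hz : c₁ z = c₂ z)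
    (hflip : ∃ i ∈ I, c₁ (Function.update z i (!z i)) ≠ c₂ (Function.update z i (!z i)))
    (η : ℝ≥0∞) (hη0 : 0 < η) (hη1 : η < 1)
    (μ : Measure (Fin n → Bool)) [IsProbabilityMeasure μ]
    (hμ : ∀ x : Fin n → Bool,
      μ {x} = (∏ i ∈ I, if x i = z i then 1 - η else η) * 2⁻¹ ^ (n - I.card))
    (m : ℕ) (A : (Fin m → (Fin n → Bool) × Bool) → ((Fin n → Bool) → Bool)) :
    2⁻¹ * expRisk n m 1 μ A c₁ + 2⁻¹ * expRisk n m 1 μ A c₂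
      ≥ 2⁻¹ * (1 - η) ^ ((m + 1) * I.card) := by
  obtain ⟨i, hi, hflip⟩ := hflip
  have hagree : ∀ x ∈ agreeOn n I z, c₁ x = c₂ x := fun x hx => by
    rw [hdep₁ x z hx, hdep₂ x z hx, hz]
  have hE : ∀ x ∈ agreeOn n I z, ∃ y, hammingDist x y ≤ 1 ∧ c₁ y ≠ c₂ y := by
    intro x hx
    have hupd : ∀ j ∈ I, Function.update x i (!z i) j = Function.update z i (!z i) j := by
      intro j hj
      by_cases h : j = i
      · subst h; simp
      · simp [h, hx j hj]
    refine ⟨Function.update x i (!z i), hammingDist_update_le_one_s4 x i _, ?_⟩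
    rwa [hdep₁ _ _ hupd, hdep₂ _ _ hupd]
  rw [ge_iff_le, ← mul_add, mul_comm (m + 1), pow_mul, ← measure_agreeOn n I z η μ hμ]
  gcongr
  exact measure_pow_le_expRisk_add_expRisk μ hagree hE m A
end

section
/- Let n ∈ ℕ and let l be an integer with 3 ≤ l ≤ n/2. Let I₁, I₂ ⊆ {1,…,n} be disjoint with |I₁| = |I₂| = l, and let c₁ = c_{I₁}, c₂ = c_{I₂} be the corresponding monotone conjunctions. Let D be the uniform distribution on {0,1}^n and let ρ be an integer with ρ ≥ l/2. Then R^E_ρ(c₁,c₂) ≥ (1 − 2^{−l})/2. -/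
open MeasureTheory ENNReal Filter

/-- Filling in the zeros of `x` on `I` moves `x` by the number of these zeros. -/
theorem hammingDist_or_mem {n : ℕ} (I : Finset (Fin n)) (x : Fin n → Bool) :
    hammingDist x (fun i => x i || decide (i ∈ I)) = (I.filter fun i => x i = false).card := by
  unfold hammingDist
  congr 1
  ext i
  cases h : x i <;> simp [h]

/-- The conjunctions of disjoint sets disagree near every point that has a zero on `J` and at most
`ρ` zeros on `I`. -/
theorem exists_monConj_ne {n ρ : ℕ} {I J : Finset (Fin n)} (hIJ : Disjoint I J)
    {x : Fin n → Bool} (hJ : ∃ i ∈ J, x i = false)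
    (hI : (I.filter fun i => x i = false).card ≤ ρ) :
    ∃ z : Fin n → Bool, hammingDist x z ≤ ρ ∧ monConj n I z ≠ monConj n J z := by
  refine ⟨fun i => x i || decide (i ∈ I), (hammingDist_or_mem I x).trans_le hI, ?_⟩
  obtain ⟨i, hi, hxi⟩ := hJ
  have hiI : i ∉ I := fun h => Finset.disjoint_left.mp hIJ h hi
  have h₁ : monConj n I (fun i => x i || decide (i ∈ I)) = true := by
    simp +contextual [monConj]
  have h₂ : monConj n J (fun i => x i || decide (i ∈ I)) = false := by
    simp only [monConj, decide_eq_false_iff_not]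
    intro h
    simpa [hxi, hiI] using h i hi
  simp [h₁, h₂]

theorem card_filter_forall_eq_true {n : ℕ} (J : Finset (Fin n)) :
    (Finset.univ.filter fun x : Fin n → Bool => ∀ i ∈ J, x i = true).card * 2 ^ J.card
      = 2 ^ n := by
  have h : (Finset.univ.filter fun x : Fin n → Bool => ∀ i ∈ J, x i = true)
      = Fintype.piFinset fun i => if i ∈ J then {true} else Finset.univ := by
    ext x
    simp only [Finset.mem_filter, Finset.mem_univ, true_and, Fintype.mem_piFinset]
    refine forall_congr' fun i => ?_
    split_ifs with hi <;> simp [hi]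
  have hJ : (2 : ℕ) ^ J.card = ∏ i : Fin n, if i ∈ J then 2 else 1 := by
    simp
  rw [h, Fintype.card_piFinset, hJ, ← Finset.prod_mul_distrib]
  calc _ = ∏ _i : Fin n, 2 := Finset.prod_congr rfl fun i _ => by split_ifs <;> simp
    _ = 2 ^ n := by simp

/-- Flipping the coordinates in `I` exchanges few and many zeros on `I`, so at least half of the
points with a zero on `J` have at most `ρ` zeros on `I`. -/
theorem card_filter_exists_le_two_mul {n ρ : ℕ} {I J : Finset (Fin n)} (hIJ : Disjoint I J)
    (hρ : I.card ≤ 2 * ρ) :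
    (Finset.univ.filter fun x : Fin n → Bool => ∃ i ∈ J, x i = false).card ≤
      2 * (Finset.univ.filter fun x : Fin n → Bool => (∃ i ∈ J, x i = false) ∧
        (I.filter fun i => x i = false).card ≤ ρ).card := by
  set G := Finset.univ.filter fun x : Fin n → Bool => (∃ i ∈ J, x i = false) ∧
        (I.filter fun i => x i = false).card ≤ ρ with hG
  let flip : (Fin n → Bool) → (Fin n → Bool) := fun x i => xor (x i) (decide (i ∈ I))
  have hflip : ∀ x, flip (flip x) = x := fun x => by
    funext i
    simp [flip]
  have hsub : (Finset.univ.filter fun x : Fin n → Bool => ∃ i ∈ J, x i = false)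
      ⊆ G ∪ G.image flip := by
    intro x hx
    obtain ⟨i, hi, hxi⟩ := (Finset.mem_filter.mp hx).2
    rw [Finset.mem_union]
    by_cases hc : (I.filter fun i => x i = false).card ≤ ρ
    · exact Or.inl (by simpa [hG, hc] using ⟨i, hi, hxi⟩)
    · refine Or.inr (Finset.mem_image.mpr ⟨flip x, ?_, hflip x⟩)
      have hiI : i ∉ I := fun h => Finset.disjoint_left.mp hIJ h hi
      have hcompl : (I.filter fun i => flip x i = false) = I.filter fun i => ¬ x i = false :=
        Finset.filter_congr fun j hj => by simp [flip, hj]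
      have hsum := Finset.card_filter_add_card_filter_not (s := I) (fun i => x i = false)
      rw [hG, Finset.mem_filter, hcompl]
      exact ⟨Finset.mem_univ _, ⟨i, hi, by simp [flip, hxi, hiI]⟩, by omega⟩
  calc _ ≤ (G ∪ G.image flip).card := Finset.card_le_card hsub
    _ ≤ G.card + (G.image flip).card := Finset.card_union_le _ _
    _ ≤ 2 * G.card := by
      have := Finset.card_image_le (s := G) (f := flip)
      omega

theorem unif_coe_finset {n : ℕ} (s : Finset (Fin n → Bool)) :
    unif n (s : Set (Fin n → Bool)) = s.card / 2 ^ n := by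
  rw [unif, PMF.toMeasure_uniformOfFintype_apply _ s.measurableSet]
  simp

/-- for disjoint monotone conjunctions of length `3 ≤ l ≤ n/2`
and radius `ρ ≥ l/2`, under the uniform distribution,
`R^E_ρ(c₁,c₂) ≥ (1 - 2^{-l})/2`. -/
theorem stmt5 (n l : ℕ) (hl3 : 3 ≤ l) (hln : 2 * l ≤ n) (ρ : ℕ) (hρ : l ≤ 2 * ρ)
    (I₁ I₂ : Finset (Fin n)) (hdisj : Disjoint I₁ I₂)
    (h1 : I₁.card = l) (h2 : I₂.card = l) :
    RE n ρ (unif n) (monConj n I₁) (monConj n I₂) ≥ (1 - 2⁻¹ ^ l) / 2 := by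
  set G := Finset.univ.filter fun x : Fin n → Bool => (∃ i ∈ I₂, x i = false) ∧
    (I₁.filter fun i => x i = false).card ≤ ρ with hG
  set T := Finset.univ.filter fun x : Fin n → Bool => ∀ i ∈ I₂, x i = true with hT
  have hGE : unif n (G : Set (Fin n → Bool)) ≤ RE n ρ (unif n) (monConj n I₁) (monConj n I₂) :=
    measure_mono fun x hx => by
      have hx' := (Finset.mem_filter.mp (Finset.mem_coe.mp hx)).2
      exact exists_monConj_ne hdisj hx'.1 hx'.2
  have hcount : 2 ^ n ≤ T.card + G.card * 2 := by
    have hA := card_filter_exists_le_two_mul (ρ := ρ) hdisj (h1.trans_le hρ)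
    have hsum := Finset.card_filter_add_card_filter_not (s := Finset.univ)
      (fun x : Fin n → Bool => ∀ i ∈ I₂, x i = true)
    simp only [not_forall, Bool.not_eq_true, exists_prop, Finset.card_univ, Fintype.card_pi,
      Fintype.card_bool, Finset.prod_const, Fintype.card_fin] at hsum
    rw [hT, hG]
    omega
  have hTcard : (T.card : ℝ≥0∞) / 2 ^ n = 2⁻¹ ^ l := by
    have h := card_filter_forall_eq_true I₂
    rw [h2] at h
    have h' : (T.card : ℝ≥0∞) * 2 ^ l = 2 ^ n := by exact_mod_cast h
    rw [← ENNReal.inv_pow]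
    refine ENNReal.eq_inv_of_mul_eq_one_left ?_
    rw [← ENNReal.mul_div_right_comm, h', ENNReal.div_self (by simp) (by simp)]
  refine le_trans ?_ hGE
  rw [unif_coe_finset]
  refine ENNReal.div_le_of_le_mul (tsub_le_iff_left.mpr ?_)
  calc (1 : ℝ≥0∞) = 2 ^ n / 2 ^ n := (ENNReal.div_self (by simp) (by simp)).symm
    _ ≤ (T.card + G.card * 2) / 2 ^ n := ENNReal.div_le_div_right (by exact_mod_cast hcount) _
    _ = 2⁻¹ ^ l + G.card / 2 ^ n * 2 := by
      rw [ENNReal.add_div, hTcard, ENNReal.mul_div_right_comm]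
end

section
/- Let l : ℕ → ℕ satisfy l(n)/log n → ∞ as n → ∞ (i.e., l(n) = ω(log n)) and let m : ℕ → ℕ satisfy m(n) ≤ n^a for some constant a ≥ 1 and all sufficiently large n. Then there exists n₀ such that for all n ≥ n₀ with 2·l(n) ≤ n and all disjoint monotone conjunctions c₁, c₂ over {0,1}^n with index sets of size l(n) each, a sample S of m(n) points drawn i.i.d. from the uniform distribution on {0,1}^n satisfies c₁(x) = c₂(x) = 0 for all x ∈ S with probability at least 1/2; indeed this probability equals (1 − 2^{−l(n)})^{2·m(n)} ≥ 1/2. -/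
open MeasureTheory ENNReal Filter

/-- The uniform measure on the hypercube is a probability measure. -/
instance unif.instIsProbabilityMeasure (n : ℕ) : IsProbabilityMeasure (unif n) :=
  PMF.toMeasure.isProbabilityMeasure _

/-- A subcube fixing the coordinates in `I` has uniform measure `2^{-|I|}`. -/
lemma unif_setOf_forall_eq_true (n : ℕ) (I : Finset (Fin n)) :
    unif n {x | ∀ i ∈ I, x i = true} = 2⁻¹ ^ I.card := by
  classical
  have hset : {x : Fin n → Bool | ∀ i ∈ I, x i = true} =
      (Fintype.piFinset fun i => if i ∈ I then {true} else Finset.univ : Finset _) := by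
    ext x
    simp only [Set.mem_ofPred_eq, Finset.mem_coe, Fintype.mem_piFinset]
    refine forall_congr' fun i => ?_
    by_cases hi : i ∈ I <;> simp [hi]
  have hcard : (Fintype.piFinset fun i : Fin n =>
      if i ∈ I then {true} else (Finset.univ : Finset Bool)).card = 2 ^ (n - I.card) := by
    have hsize (i : Fin n) : (if i ∈ I then {true} else (Finset.univ : Finset Bool)).card =
        if i ∈ I then 1 else 2 := by
      split_ifs <;> simp
    simp_rw [Fintype.card_piFinset, hsize, Finset.prod_ite, Finset.prod_const]
    rw [one_pow, one_mul, Finset.filter_not, Finset.filter_mem_eq_inter,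
      Finset.univ_inter, Finset.card_univ_sdiff, Fintype.card_fin]
  have hle : I.card ≤ n := by simpa using I.card_le_univ
  rw [unif, PMF.toMeasure_uniformOfFintype_apply _ (Set.toFinite _).measurableSet]
  simp only [hset, Finset.coe_sort_coe, Fintype.card_coe, hcard, Fintype.card_pi, Fintype.card_bool,
    Finset.prod_const, Finset.card_univ, Fintype.card_fin]
  push_cast
  rw [← ENNReal.inv_pow, ENNReal.div_eq_inv_mul]
  have h2 : (2 : ℝ≥0∞) ^ n = 2 ^ I.card * 2 ^ (n - I.card) := by
    rw [← pow_add, Nat.add_sub_cancel' hle]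
  rw [h2, ENNReal.mul_inv (by simp) (by simp), mul_assoc,
    ENNReal.inv_mul_cancel (by simp) (by simp), mul_one]

/-- Two disjoint monotone conjunctions both vanish with probability
`(1 - 2^{-|I₁|}) (1 - 2^{-|I₂|})`. -/
lemma unif_setOf_monConj_eq_false (n : ℕ) {I₁ I₂ : Finset (Fin n)} (h : Disjoint I₁ I₂) :
    unif n {x | monConj n I₁ x = false ∧ monConj n I₂ x = false} =
      (1 - 2⁻¹ ^ I₁.card) * (1 - 2⁻¹ ^ I₂.card) := by
  set A : Finset (Fin n) → Set (Fin n → Bool) := fun I => {x | ∀ i ∈ I, x i = true} with hA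
  have hmeas (I) : MeasurableSet (A I) := (Set.toFinite _).measurableSet
  have hinter : A I₁ ∩ A I₂ = A (I₁.disjUnion I₂ h) := by
    ext x
    simp only [hA, Set.mem_inter_iff, Set.mem_ofPred_eq, Finset.mem_disjUnion, or_imp, forall_and]
  have hindep : ProbabilityTheory.IndepSet (A I₁) (A I₂) (unif n) := by
    rw [ProbabilityTheory.indepSet_iff_measure_inter_eq_mul (hmeas _) (hmeas _) (unif n), hinter]
    simp only [hA, unif_setOf_forall_eq_true, Finset.card_disjUnion, pow_add]
  have hcompl : {x | monConj n I₁ x = false ∧ monConj n I₂ x = false} = (A I₁)ᶜ ∩ (A I₂)ᶜ := by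
    ext x
    simp [hA, monConj]
  rw [hcompl, (ProbabilityTheory.Indep_iff _ _ _).1 hindep _ _
      (MeasurableSpace.measurableSet_generateFrom (Set.mem_singleton _)).compl
      (MeasurableSpace.measurableSet_generateFrom (Set.mem_singleton _)).compl,
    prob_compl_eq_one_sub (hmeas _), prob_compl_eq_one_sub (hmeas _)]
  simp only [hA, unif_setOf_forall_eq_true]

/-- By Bernoulli's inequality, `(1 - 2^{-l})^{2m} ≥ 1/2` as soon as `4m ≤ 2^l`. -/
lemma one_half_le_one_sub_pow {l m : ℕ} (h : 4 * (m : ℝ) ≤ 2 ^ l) :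
    (2⁻¹ : ℝ≥0∞) ≤ (1 - 2⁻¹ ^ l) ^ (2 * m) := by
  have hp : (2⁻¹ : ℝ) ^ l ≤ 1 := pow_le_one₀ (by norm_num) (by norm_num)
  have hreal : (2⁻¹ : ℝ) ≤ (1 - 2⁻¹ ^ l) ^ (2 * m) := by
    have hb := one_add_mul_le_pow (a := -(2⁻¹ : ℝ) ^ l) (by linarith) (2 * m)
    have hm : 4 * (m : ℝ) * 2⁻¹ ^ l ≤ 1 := by
      rw [inv_pow]
      exact (mul_inv_le_iff₀ (by positivity)).2 (by linarith)
    push_cast at hb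
    rw [← sub_eq_add_neg] at hb
    linarith
  have := ENNReal.ofReal_le_ofReal hreal
  rwa [ENNReal.ofReal_pow (by linarith), ENNReal.ofReal_sub _ (by positivity),
    ENNReal.ofReal_pow (by norm_num), ENNReal.ofReal_one, ENNReal.ofReal_inv_of_pos (by norm_num),
    ENNReal.ofReal_ofNat] at this

/-- A length `l(n) = ω(log n)` makes `2^{l(n)}` outgrow four times any polynomial bound. -/
lemma eventually_four_mul_rpow_le_two_pow {l : ℕ → ℕ}
    (hl : Tendsto (fun n : ℕ => (l n : ℝ) / Real.log n) atTop atTop) (a : ℝ) :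
    ∀ᶠ n : ℕ in atTop, 4 * (n : ℝ) ^ a ≤ 2 ^ l n := by
  filter_upwards [hl.eventually_ge_atTop ((a + 2) / Real.log 2), eventually_ge_atTop 2]
    with n hn hn2
  have hn2' : (2 : ℝ) ≤ n := by exact_mod_cast hn2
  have hlog : 0 < Real.log n := Real.log_pos (by linarith)
  have hlog2 : 0 < Real.log 2 := Real.log_pos (by norm_num)
  calc 4 * (n : ℝ) ^ a ≤ (n : ℝ) ^ a * (n : ℝ) ^ 2 := by
        rw [mul_comm]
        gcongr
        nlinarith
    _ = (n : ℝ) ^ (a + 2) := by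
        rw [Real.rpow_add (by linarith), Real.rpow_two]
    _ ≤ 2 ^ l n := by
        rw [← Real.log_le_log_iff (by positivity) (by positivity),
          Real.log_rpow (by linarith), Real.log_pow]
        rwa [div_le_div_iff₀ hlog2 hlog] at hn

/-- if `l(n) = ω(log n)` and `m(n) ≤ n^a` eventually, then for all
large enough `n` (with `2·l(n) ≤ n`) and all disjoint monotone conjunctions of
length `l(n)`, an i.i.d. uniform `m(n)`-sample is labeled all-zero by both
conjunctions with probability exactly `(1 - 2^{-l(n)})^{2m(n)} ≥ 1/2`. -/
theorem stmt6 (l m : ℕ → ℕ) (a : ℝ) (ha : 1 ≤ a)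
    (hl : Tendsto (fun n : ℕ => (l n : ℝ) / Real.log n) atTop atTop)
    (hm : ∀ᶠ n : ℕ in atTop, (m n : ℝ) ≤ (n : ℝ) ^ a) :
    ∃ n₀ : ℕ, ∀ n ≥ n₀, 2 * l n ≤ n →
      ∀ I₁ I₂ : Finset (Fin n), Disjoint I₁ I₂ → I₁.card = l n → I₂.card = l n →
        (Measure.pi fun _ : Fin (m n) => unif n)
            {S : Fin (m n) → (Fin n → Bool) |
              ∀ i, monConj n I₁ (S i) = false ∧ monConj n I₂ (S i) = false}
          = (1 - 2⁻¹ ^ l n) ^ (2 * m n) ∧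
        (2⁻¹ : ℝ≥0∞) ≤ (1 - 2⁻¹ ^ l n) ^ (2 * m n) := by
  refine eventually_atTop.1 ?_
  filter_upwards [hm, eventually_four_mul_rpow_le_two_pow hl a] with n hmn hln
  intro _ I₁ I₂ hI h₁ h₂
  refine ⟨?_, one_half_le_one_sub_pow (by linarith)⟩
  have hset : {S : Fin (m n) → (Fin n → Bool) |
        ∀ i, monConj n I₁ (S i) = false ∧ monConj n I₂ (S i) = false} =
      Set.univ.pi fun _ => {x | monConj n I₁ x = false ∧ monConj n I₂ x = false} := by
    ext S
    simp
  rw [hset, Measure.pi_pi, Finset.prod_const, Finset.card_univ, Fintype.card_fin,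
    unif_setOf_monConj_eq_false n hI, h₁, h₂, ← sq, ← pow_mul]
end

section
/- Let α ≥ 1, let D be an α-log-Lipschitz distribution on {0,1}^n, and set η = 1/(1+α). Let c = c_I be a monotone conjunction with |I| = l. For a labeled sample S, let A(S) be the monotone conjunction with index set J(S) = {i ∈ {1,…,n} : every (x,y) ∈ S with y = 1 has x_i = 1} (the standard elimination algorithm for conjunctions). If δ ∈ (0,1) and m ≥ (ln n − ln δ)/η^{l+1}, then Pr_{S∼D^m}[A(S_c) = c] ≥ 1 − δ, i.e., with probability at least 1 − δ the algorithm outputs exactly the target conjunction. -/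
open MeasureTheory ENNReal Filter

/-- The standard elimination algorithm for monotone conjunctions: keep exactly
those variables that equal `1` in every positively-labeled example. -/
def elimAlg (n m : ℕ) (S : Fin m → (Fin n → Bool) × Bool) : (Fin n → Bool) → Bool :=
  monConj n (Finset.univ.filter fun i : Fin n =>
    ∀ j : Fin m, (S j).2 = true → (S j).1 i = true)

/-- Adjacent points of the hypercube have masses within a factor `α` of each other. -/
lemma logLipschitz.real_singleton_le {n : ℕ} {α : ℝ} (hα : 1 ≤ α)
    {μ : Measure (Fin n → Bool)} [IsProbabilityMeasure μ] (hμ : logLipschitz n α μ)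
    {x y : Fin n → Bool} (hxy : hammingDist x y = 1) :
    μ.real {x} ≤ α * μ.real {y} := by
  have hpos : ∀ z, 0 < μ.real {z} := fun z =>
    ENNReal.toReal_pos (hμ.1 z).ne' (measure_ne_top _ _)
  have h : Real.log (μ.real {x}) - Real.log (μ.real {y}) ≤ Real.log α :=
    (le_abs_self _).trans (hμ.2 x y hxy)
  have hα0 : 0 < α := by linarith
  rw [← Real.log_le_log_iff (hpos x) (mul_pos hα0 (hpos y)),
    Real.log_mul hα0.ne' (hpos y).ne']
  linarith

lemma hammingDist_update_not {n : ℕ} (x : Fin n → Bool) (a : Fin n) :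
    hammingDist x (Function.update x a (!x a)) = 1 := by
  rw [hammingDist, Finset.card_eq_one]
  refine ⟨a, ?_⟩
  ext i
  by_cases h : i = a
  · subst h; simp
  · simp [h]

/-- Under an `α`-log-Lipschitz distribution, a subcube of codimension `k` has mass at least
`(1 / (1 + α)) ^ k`. -/
lemma logLipschitz.pow_card_le_real_subcube {n : ℕ} {α : ℝ} (hα : 1 ≤ α)
    {μ : Measure (Fin n → Bool)} [IsProbabilityMeasure μ] (hμ : logLipschitz n α μ)
    (b : Fin n → Bool) (J : Finset (Fin n)) :
    (1 / (1 + α)) ^ J.card ≤ μ.real {x | ∀ j ∈ J, x j = b j} := by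
  classical
  have hsum : ∀ P : (Fin n → Bool) → Prop,
      μ.real {x | P x} = ∑ x with P x, μ.real {x} := by
    intro P
    rw [sum_measureReal_singleton]
    simp
  induction J using Finset.induction_on with
  | empty => simp
  | insert a J ha ih =>
    have hsplit : μ.real {x | ∀ j ∈ J, x j = b j} ≤
        (1 + α) * μ.real {x | ∀ j ∈ insert a J, x j = b j} := by
      have hunion : {x : Fin n → Bool | ∀ j ∈ J, x j = b j} =
          {x | ∀ j ∈ insert a J, x j = b j} ∪ {x | x a ≠ b a ∧ ∀ j ∈ J, x j = b j} := by
        ext x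
        simp only [Finset.forall_mem_insert, Set.mem_union, Set.mem_ofPred_eq]
        tauto
      have hflip : μ.real {x | x a ≠ b a ∧ ∀ j ∈ J, x j = b j} ≤
          α * μ.real {x | ∀ j ∈ insert a J, x j = b j} := by
        rw [hsum, hsum, Finset.mul_sum]
        refine (Finset.sum_le_sum fun x _ =>
          hμ.real_singleton_le hα (hammingDist_update_not x a)).trans (le_of_eq ?_)
        have hne : ∀ j ∈ J, j ≠ a := fun j hj h => ha (h ▸ hj)
        refine Finset.sum_nbij' (fun x => Function.update x a (!x a))
          (fun x => Function.update x a (!x a)) ?_ ?_ ?_ ?_ ?_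
        · intro x hx
          simp only [Finset.mem_filter_univ, Finset.forall_mem_insert] at hx ⊢
          refine ⟨by simpa [Bool.not_eq_eq_eq_not, Bool.eq_not] using hx.1, fun j hj => ?_⟩
          rw [Function.update_of_ne (hne j hj)]
          exact hx.2 j hj
        · intro x hx
          simp only [Finset.mem_filter_univ, Finset.forall_mem_insert] at hx ⊢
          refine ⟨by simp [hx.1], fun j hj => ?_⟩
          rw [Function.update_of_ne (hne j hj)]
          exact hx.2 j hj
        · intro x _
          simp
        · intro x _
          simp
        · intro x _
          rfl
      rw [hunion]
      refine (measureReal_union_le _ _).trans ?_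
      linarith
    have hα1 : 0 < 1 + α := by linarith
    rw [Finset.card_insert_of_notMem ha, pow_succ, mul_one_div, div_le_iff₀ hα1]
    linarith

/-- The elimination algorithm recovers the target as soon as every irrelevant variable vanishes
in some positive example. -/
lemma elimAlg_labelWith_monConj {n m : ℕ} {I : Finset (Fin n)} {S : Fin m → (Fin n → Bool)}
    (h : ∀ i ∉ I, ∃ j, (∀ k ∈ I, S j k = true) ∧ S j i = false) :
    elimAlg n m (labelWith n (monConj n I) S) = monConj n I := by
  rw [elimAlg]
  congr 1
  ext i
  simp only [labelWith, monConj, decide_eq_true_eq, Finset.mem_filter_univ]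
  refine ⟨fun hi => ?_, fun hi j hj => hj i hi⟩
  by_contra hiI
  obtain ⟨j, hj, hji⟩ := h i hiI
  simp [hi j hj] at hji

/-- The probability that `m` independent samples all avoid a set of mass at least `p`. -/
lemma pi_forall_notMem_le {Ω : Type*} [MeasurableSpace Ω] (μ : Measure Ω)
    [IsProbabilityMeasure μ] {s : Set Ω} (hs : MeasurableSet s) {p : ℝ} (hp : p ≤ μ.real s)
    (m : ℕ) :
    (Measure.pi fun _ : Fin m => μ) {S | ∀ j, S j ∉ s} ≤
      ENNReal.ofReal (Real.exp (-(m * p))) := by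
  have hset : {S : Fin m → Ω | ∀ j, S j ∉ s} = Set.univ.pi fun _ => sᶜ := by
    ext S
    simp
  have hcompl : μ sᶜ ≤ ENNReal.ofReal (Real.exp (-p)) := by
    rw [← ofReal_measureReal, probReal_compl_eq_one_sub hs]
    refine ENNReal.ofReal_le_ofReal ?_
    have := Real.add_one_le_exp (-p)
    linarith
  rw [hset, Measure.pi_pi, Finset.prod_const, Finset.card_univ, Fintype.card_fin,
    neg_mul_eq_mul_neg, Real.exp_nat_mul, ENNReal.ofReal_pow (Real.exp_nonneg _)]
  gcongr

/-- under an `α`-log-Lipschitz distribution, with `η = 1/(1+α)`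
and sample size `m ≥ (ln n − ln δ)/η^{l+1}`, the elimination algorithm outputs
exactly the target monotone conjunction with probability `≥ 1 − δ`. -/
theorem stmt9 (n : ℕ) (α : ℝ) (hα : 1 ≤ α) (μ : Measure (Fin n → Bool))
    [IsProbabilityMeasure μ] (hμ : logLipschitz n α μ)
    (I : Finset (Fin n)) (l : ℕ) (hl : I.card = l)
    (δ : ℝ) (hδ0 : 0 < δ) (hδ1 : δ < 1) (m : ℕ)
    (hm : (Real.log n - Real.log δ) / (1 / (1 + α)) ^ (l + 1) ≤ (m : ℝ)) :
    (Measure.pi fun _ : Fin m => μ)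
        {S : Fin m → (Fin n → Bool) |
          elimAlg n m (labelWith n (monConj n I) S) = monConj n I}
      ≥ 1 - ENNReal.ofReal δ := by
  classical
  subst hl
  set p : ℝ := (1 / (1 + α)) ^ (I.card + 1) with hp
  have hp0 : 0 < p := by positivity
  let good : Fin n → Set (Fin n → Bool) := fun i =>
    {x | (∀ k ∈ I, x k = true) ∧ x i = false}
  have hgood : ∀ i ∉ I, p ≤ μ.real (good i) := by
    intro i hi
    have h := hμ.pow_card_le_real_subcube hα (fun k => decide (k ∈ I)) (insert i I)
    rw [Finset.card_insert_of_notMem hi] at h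
    refine h.trans (measureReal_mono fun x hx => ?_)
    simp only [Set.mem_ofPred_eq, Finset.forall_mem_insert, hi, decide_false] at hx
    exact ⟨fun k hk => by simpa [hk] using hx.2 k hk, hx.1⟩
  set E : Set (Fin m → (Fin n → Bool)) :=
    {S | elimAlg n m (labelWith n (monConj n I) S) = monConj n I} with hE
  have hsub : Eᶜ ⊆ ⋃ i ∈ Iᶜ, {S : Fin m → (Fin n → Bool) | ∀ j, S j ∉ good i} := by
    intro S hS
    by_contra hcon
    refine hS (elimAlg_labelWith_monConj fun i hi => ?_)
    by_contra hj
    refine hcon (Set.mem_biUnion (by simpa using hi) fun j hgj => hj ⟨j, hgj⟩)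
  have hexp : (n : ℝ) * Real.exp (-(m * p)) ≤ δ := by
    rcases Nat.eq_zero_or_pos n with rfl | hn
    · simpa using hδ0.le
    · have hn0 : (0 : ℝ) < n := by exact_mod_cast hn
      rw [div_le_iff₀ hp0] at hm
      calc (n : ℝ) * Real.exp (-(m * p)) ≤ n * Real.exp (Real.log δ - Real.log n) := by
            gcongr
            linarith
        _ = δ := by
            rw [Real.exp_sub, Real.exp_log hδ0, Real.exp_log hn0]
            field_simp
  have hfail : (Measure.pi fun _ : Fin m => μ) Eᶜ ≤ ENNReal.ofReal δ := by
    calc (Measure.pi fun _ : Fin m => μ) Eᶜ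
        ≤ ∑ i ∈ Iᶜ, (Measure.pi fun _ : Fin m => μ) {S | ∀ j, S j ∉ good i} :=
          (measure_mono hsub).trans (measure_biUnion_finset_le _ _)
      _ ≤ ∑ _i ∈ Iᶜ, ENNReal.ofReal (Real.exp (-(m * p))) :=
          Finset.sum_le_sum fun i hi => pi_forall_notMem_le μ (Set.toFinite _).measurableSet
            (hgood i (Finset.mem_compl.1 hi)) m
      _ ≤ ∑ _i : Fin n, ENNReal.ofReal (Real.exp (-(m * p))) :=
          Finset.sum_le_sum_of_subset (Finset.subset_univ _)
      _ = ENNReal.ofReal (n * Real.exp (-(m * p))) := by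
          rw [ENNReal.ofReal_mul n.cast_nonneg]
          simp
      _ ≤ ENNReal.ofReal δ := ENNReal.ofReal_le_ofReal hexp
  rw [ge_iff_le, tsub_le_iff_right]
  calc (1 : ℝ≥0∞) = (Measure.pi fun _ : Fin m => μ) (E ∪ Eᶜ) := by simp
    _ ≤ (Measure.pi fun _ : Fin m => μ) E + (Measure.pi fun _ : Fin m => μ) Eᶜ :=
        measure_union_le _ _
    _ ≤ _ := by gcongr
end

section
/- Let α ≥ 1, let D be an α-log-Lipschitz distribution on {0,1}^n, and set η = 1/(1+α). Let c = c_I be a monotone conjunction with |I| = l, let ε ∈ (0,1), and let ρ ≥ 0. If l ≥ (8/η²)·ln(1/ε) and ρ ≤ η·l/2, then Pr_{x∼D}[∃ z ∈ B_ρ(x), c(z) = 1] ≤ ε. -/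
open MeasureTheory ENNReal Filter

/-- The number of zeros of `x` inside `I`. -/
def zeroCount {n : ℕ} (I : Finset (Fin n)) (x : Fin n → Bool) : ℕ :=
  (I.filter fun i => x i = false).card

/-- Flipping the `i`-th coordinate of a point of the hypercube. -/
def flipAt {n : ℕ} (i : Fin n) (x : Fin n → Bool) : Fin n → Bool :=
  Function.update x i (!x i)

lemma flipAt_involutive {n : ℕ} (i : Fin n) : Function.Involutive (flipAt i) := by
  intro x
  simp [flipAt]

lemma hammingDist_flipAt {n : ℕ} (i : Fin n) (x : Fin n → Bool) :
    hammingDist x (flipAt i x) = 1 := by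
  have h : (Finset.univ.filter fun j => x j ≠ flipAt i x j) = {i} := by
    ext j
    rw [Finset.mem_filter, Finset.mem_singleton]
    by_cases hj : j = i
    · subst hj
      simp [flipAt]
    · simp [flipAt, hj]
  rw [hammingDist, h, Finset.card_singleton]

lemma zeroCount_flipAt {n : ℕ} {i : Fin n} {J : Finset (Fin n)} (hi : i ∉ J)
    (x : Fin n → Bool) : zeroCount J (flipAt i x) = zeroCount J x := by
  unfold zeroCount
  congr 1
  refine Finset.filter_congr fun j hj => ?_
  have hji : j ≠ i := fun h => hi (h ▸ hj)
  simp [flipAt, hji]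

lemma zeroCount_insert {n : ℕ} {i : Fin n} {J : Finset (Fin n)} (hi : i ∉ J)
    (x : Fin n → Bool) :
    zeroCount (insert i J) x = zeroCount J x + if x i = false then 1 else 0 := by
  unfold zeroCount
  rw [Finset.filter_insert]
  split_ifs with h
  · rw [Finset.card_insert_of_notMem (by simp [hi])]
  · simp

lemma zeroCount_le_hammingDist {n : ℕ} {I : Finset (Fin n)} {x z : Fin n → Bool}
    (hz : monConj n I z = true) : zeroCount I x ≤ hammingDist x z := by
  have hz' : ∀ i ∈ I, z i = true := by simpa [monConj] using hz
  refine Finset.card_le_card fun i hi => ?_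
  rw [Finset.mem_filter] at hi
  simp [hi.2, hz' i hi.1]

/-- Exponential moment bound for the number of zeros inside `I`, for a weight whose values at
neighbouring points differ by a factor of at most `α`. -/
lemma sum_mul_half_pow_zeroCount_le {n : ℕ} {α : ℝ} (hα : 1 ≤ α) {p : (Fin n → Bool) → ℝ}
    (hp : ∀ x x', hammingDist x x' = 1 → p x ≤ α * p x') (I : Finset (Fin n)) :
    ∑ x, p x * (1 / 2 : ℝ) ^ zeroCount I x
      ≤ (1 - 1 / (1 + α) / 2) ^ I.card * ∑ x, p x := by
  have hα' : 0 < 1 + α := by linarith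
  have hη : 1 / (1 + α) ≤ 1 := by
    rw [div_le_one hα']
    linarith
  induction I using Finset.induction_on with
  | empty => simp [zeroCount]
  | insert i J hi ih =>
    set q : ℝ := 1 - 1 / (1 + α) / 2 with hq
    have hq0 : 0 ≤ q := by linarith
    let f : (Fin n → Bool) → ℝ := fun x => p x * (1 / 2 : ℝ) ^ zeroCount (insert i J) x
    let g : (Fin n → Bool) → ℝ := fun x => p x * (1 / 2 : ℝ) ^ zeroCount J x
    have hflip (h : (Fin n → Bool) → ℝ) : ∑ x, h (flipAt i x) = ∑ x, h x :=
      Equiv.sum_comp (flipAt_involutive i).toPerm h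
    have hg (x : Fin n → Bool) : g (flipAt i x) ≤ α * g x := by
      have h := hp (flipAt i x) x (by rw [hammingDist_comm, hammingDist_flipAt])
      simp only [g, zeroCount_flipAt hi]
      rw [← mul_assoc]
      gcongr
    have hf (x : Fin n → Bool) : f x = g x * if x i = false then 1 / 2 else 1 := by
      simp only [f, g, zeroCount_insert hi, pow_add]
      split_ifs <;> ring
    have key {a b : ℝ} (hab : b ≤ α * a) : a / 2 + b ≤ q * (a + b) := by
      have h : 1 / (1 + α) * (a + b) ≤ a := by
        rw [one_div_mul_eq_div, div_le_iff₀ hα']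
        linarith
      rw [hq]
      linarith
    have hpair (x : Fin n → Bool) : f x + f (flipAt i x) ≤ q * (g x + g (flipAt i x)) := by
      rw [hf x, hf (flipAt i x)]
      have h1 := hg x
      have h2 := hg (flipAt i x)
      rw [flipAt_involutive i x] at h2
      cases hx : x i
      · have := key h1
        simp only [flipAt, hx, Function.update_self] at this ⊢
        norm_num at this ⊢
        linarith
      · have := key h2
        simp only [flipAt, hx, Function.update_self] at this ⊢
        norm_num at this ⊢
        linarith
    have hsum : ∑ x, f x ≤ q * ∑ x, g x := by
      have h := Finset.sum_le_sum fun x (_ : x ∈ Finset.univ) => hpair x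
      rw [← Finset.mul_sum, Finset.sum_add_distrib, Finset.sum_add_distrib, hflip, hflip] at h
      linarith
    calc ∑ x, f x ≤ q * ∑ x, g x := hsum
      _ ≤ q * (q ^ J.card * ∑ x, p x) := by gcongr
      _ = q ^ (insert i J).card * ∑ x, p x := by
        rw [Finset.card_insert_of_notMem hi, pow_succ]
        ring

lemma logLipschitz.measureReal_singleton_le {n : ℕ} {α : ℝ} (hα : 1 ≤ α)
    {μ : Measure (Fin n → Bool)} [IsFiniteMeasure μ] (hμ : logLipschitz n α μ)
    (x x' : Fin n → Bool) (h : hammingDist x x' = 1) :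
    μ.real {x} ≤ α * μ.real {x'} := by
  have hpos (y : Fin n → Bool) : 0 < μ.real {y} :=
    ENNReal.toReal_pos (hμ.1 y).ne' (measure_ne_top μ _)
  have h1 := (abs_le.1 (hμ.2 x x' h)).2
  rw [← Real.log_le_log_iff (hpos x) (mul_pos (by linarith) (hpos x')),
    Real.log_mul (by linarith) (hpos x').ne']
  simp only [Measure.real]
  linarith

/-- Markov's inequality for the number of zeros inside `I`. -/
lemma logLipschitz.measureReal_zeroCount_le {n : ℕ} {α : ℝ} (hα : 1 ≤ α)
    {μ : Measure (Fin n → Bool)} [IsProbabilityMeasure μ] (hμ : logLipschitz n α μ)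
    (I : Finset (Fin n)) (ρ : ℕ) :
    μ.real {x | zeroCount I x ≤ ρ} ≤ 2 ^ ρ * (1 - 1 / (1 + α) / 2) ^ I.card := by
  have hS : ({x | zeroCount I x ≤ ρ} : Set (Fin n → Bool))
      = ↑(Finset.univ.filter fun x : Fin n → Bool => zeroCount I x ≤ ρ) := by
    ext x
    simp
  have hone : ∑ x, μ.real {x} = 1 := by
    rw [sum_measureReal_singleton]
    simp
  have hm := sum_mul_half_pow_zeroCount_le hα (hμ.measureReal_singleton_le hα) I
  rw [hone, mul_one] at hm
  rw [hS, ← sum_measureReal_singleton]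
  calc ∑ x with zeroCount I x ≤ ρ, μ.real {x}
      ≤ ∑ x with zeroCount I x ≤ ρ, 2 ^ ρ * (μ.real {x} * (1 / 2 : ℝ) ^ zeroCount I x) := by
        refine Finset.sum_le_sum fun x hx => ?_
        have hx' : zeroCount I x ≤ ρ := (Finset.mem_filter.1 hx).2
        have h1 : (1 : ℝ) ≤ 2 ^ ρ * (1 / 2 : ℝ) ^ zeroCount I x := by
          rw [one_div, inv_pow, ← div_eq_mul_inv, one_le_div (by positivity)]
          exact pow_le_pow_right₀ one_le_two hx'
        calc μ.real {x} = μ.real {x} * 1 := (mul_one _).symm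
          _ ≤ μ.real {x} * (2 ^ ρ * (1 / 2 : ℝ) ^ zeroCount I x) := by gcongr
          _ = _ := by ring
    _ ≤ ∑ x, 2 ^ ρ * (μ.real {x} * (1 / 2 : ℝ) ^ zeroCount I x) :=
        Finset.sum_le_sum_of_subset_of_nonneg (Finset.filter_subset _ _)
          fun _ _ _ => by positivity
    _ ≤ _ := by
        rw [← Finset.mul_sum]
        gcongr

lemma two_pow_mul_one_sub_half_pow_le {η ε : ℝ} (hη0 : 0 < η) (hη1 : η ≤ 1) (hε : 0 < ε)
    {l ρ : ℕ} (hl : 8 / η ^ 2 * Real.log (1 / ε) ≤ l) (hρ : (ρ : ℝ) ≤ η * l / 2) :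
    2 ^ ρ * (1 - η / 2) ^ l ≤ ε := by
  have h2 : (2 : ℝ) ^ ρ = Real.exp (ρ * Real.log 2) := by
    rw [Real.exp_nat_mul, Real.exp_log two_pos]
  have h3 : (1 - η / 2) ^ l ≤ Real.exp (l * (-(η / 2))) := by
    rw [Real.exp_nat_mul]
    exact pow_le_pow_left₀ (by linarith) (Real.one_sub_le_exp_neg _) _
  have hlog : 8 * Real.log (1 / ε) ≤ l * η ^ 2 := by
    rwa [div_mul_eq_mul_div, div_le_iff₀ (by positivity)] at hl
  rw [one_div, Real.log_inv] at hlog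
  have hηl : l * η ^ 2 ≤ l * η := by
    gcongr
    nlinarith
  have hln2 := Real.log_two_lt_d9
  have h4 : ρ * Real.log 2 ≤ η * l / 2 * 0.7 := by
    gcongr
    linarith
  have h5 : (0 : ℝ) ≤ l * η := by positivity
  calc 2 ^ ρ * (1 - η / 2) ^ l
      ≤ Real.exp (ρ * Real.log 2) * Real.exp (l * (-(η / 2))) := by
        rw [h2]
        gcongr
    _ = Real.exp (ρ * Real.log 2 + l * (-(η / 2))) := (Real.exp_add _ _).symm
    _ ≤ Real.exp (Real.log ε) := by
        gcongr
        linarith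
    _ = ε := Real.exp_log hε

/-- under an `α`-log-Lipschitz distribution, with `η = 1/(1+α)`,
if `l ≥ (8/η²)·ln(1/ε)` and `ρ ≤ η·l/2`, then the probability that some point
in the `ρ`-ball around a random `x` satisfies the length-`l` monotone
conjunction is at most `ε`. -/
theorem stmt10 (n : ℕ) (α : ℝ) (hα : 1 ≤ α) (μ : Measure (Fin n → Bool))
    [IsProbabilityMeasure μ] (hμ : logLipschitz n α μ)
    (I : Finset (Fin n)) (l : ℕ) (hl : I.card = l)
    (ε : ℝ) (hε0 : 0 < ε) (hε1 : ε < 1) (ρ : ℕ)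
    (hlε : 8 / (1 / (1 + α)) ^ 2 * Real.log (1 / ε) ≤ (l : ℝ))
    (hρ : (ρ : ℝ) ≤ (1 / (1 + α)) * l / 2) :
    μ {x | ∃ z : Fin n → Bool, hammingDist x z ≤ ρ ∧ monConj n I z = true}
      ≤ ENNReal.ofReal ε := by
  subst hl
  have hα' : 0 < 1 + α := by linarith
  have hη1 : 1 / (1 + α) ≤ 1 := by
    rw [div_le_one hα']
    linarith
  calc μ {x | ∃ z : Fin n → Bool, hammingDist x z ≤ ρ ∧ monConj n I z = true}
      ≤ μ {x | zeroCount I x ≤ ρ} :=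
        measure_mono fun x ⟨_, hz, hc⟩ => (zeroCount_le_hammingDist hc).trans hz
    _ = ENNReal.ofReal (μ.real {x | zeroCount I x ≤ ρ}) := (ofReal_measureReal).symm
    _ ≤ ENNReal.ofReal ε := ENNReal.ofReal_le_ofReal <|
        (hμ.measureReal_zeroCount_le hα I ρ).trans <|
          two_pow_mul_one_sub_half_pow_le (by positivity) hη1 hε0 hlε hρ
end

section
/- Let α ≥ 1 and C > 0 be constants. There exist a learning algorithm A (a function mapping labeled samples over {0,1}^n to hypotheses h : {0,1}^n → {0,1}, for each n) and a polynomial p such that for every n ∈ ℕ, every α-log-Lipschitz distribution D on {0,1}^n, every monotone conjunction c over {0,1}^n, every ε, δ ∈ (0,1), and every robustness parameter ρ ≤ C·log n: if m ≥ p(n, 1/ε, 1/δ), then Pr_{S∼D^m}[R^E_ρ(A(S_c), c) ≤ ε] ≥ 1 − δ. That is, monotone conjunctions are ρ-robustly learnable with polynomial sample complexity with respect to α-log-Lipschitz distributions for ρ(n) = O(log n). -/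
open MeasureTheory ENNReal Filter

/-- Flip the `i`-th bit of `x`. -/
def flipBit {n : ℕ} (i : Fin n) (x : Fin n → Bool) : Fin n → Bool :=
  Function.update x i (!x i)

lemma flipBit_involutive {n : ℕ} (i : Fin n) : Function.Involutive (flipBit i) := by
  intro x
  simp [flipBit]

lemma flipBit_apply_self {n : ℕ} (i : Fin n) (x : Fin n → Bool) : flipBit i x i = !x i := by
  simp [flipBit]

lemma flipBit_apply_of_ne {n : ℕ} {i j : Fin n} (h : j ≠ i) (x : Fin n → Bool) :
    flipBit i x j = x j := by
  simp [flipBit, h]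

lemma hammingDist_flipBit {n : ℕ} (i : Fin n) (x : Fin n → Bool) :
    hammingDist (flipBit i x) x = 1 := by
  unfold hammingDist
  rw [Finset.card_eq_one]
  refine ⟨i, ?_⟩
  ext j
  by_cases h : j = i
  · subst h
    simp [flipBit_apply_self]
  · simp [flipBit_apply_of_ne h, h]

lemma logLipschitz.measureReal_flipBit_le {n : ℕ} {α : ℝ} (hα : 1 ≤ α)
    {μ : Measure (Fin n → Bool)} [IsProbabilityMeasure μ] (h : logLipschitz n α μ)
    (i : Fin n) (x : Fin n → Bool) : μ.real {flipBit i x} ≤ α * μ.real {x} := by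
  have pos : ∀ y, 0 < μ.real {y} := fun y =>
    ENNReal.toReal_pos (h.1 y).ne' (measure_ne_top _ _)
  have h1 := (abs_le.1 (h.2 _ _ (hammingDist_flipBit i x))).2
  change Real.log (μ.real {flipBit i x}) - Real.log (μ.real {x}) ≤ Real.log α at h1
  have hα0 : 0 < α := by linarith
  rw [← Real.log_le_log_iff (pos _) (mul_pos hα0 (pos x)), Real.log_mul hα0.ne' (pos x).ne']
  linarith

/-- Each bit takes each value with conditional probability at least `1 / (1 + α)` given the
others. -/
lemma logLipschitz.sum_le_sum_ite {n : ℕ} {α : ℝ} (hα : 1 ≤ α)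
    {μ : Measure (Fin n → Bool)} [IsProbabilityMeasure μ] (h : logLipschitz n α μ)
    (i : Fin n) (b : Bool) (g : (Fin n → Bool) → ℝ) (hg : ∀ x, 0 ≤ g x)
    (hgi : ∀ x, g (flipBit i x) = g x) :
    ∑ x, μ.real {x} * g x ≤ (1 + α) * ∑ x, if x i = b then μ.real {x} * g x else 0 := by
  have split : ∑ x, μ.real {x} * g x = (∑ x, if x i = b then μ.real {x} * g x else 0) +
      ∑ x, if x i = b then 0 else μ.real {x} * g x := by
    rw [← Finset.sum_add_distrib]
    exact Finset.sum_congr rfl fun x _ => by split_ifs <;> simp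
  have flip : (∑ x, if x i = b then 0 else μ.real {x} * g x) ≤
      α * ∑ x, if x i = b then μ.real {x} * g x else 0 := by
    rw [← Equiv.sum_comp ((flipBit_involutive i).toPerm), Finset.mul_sum]
    refine Finset.sum_le_sum fun x _ => ?_
    simp only [Function.Involutive.coe_toPerm, flipBit_apply_self, hgi]
    have := mul_le_mul_of_nonneg_right (h.measureReal_flipBit_le hα i x) (hg x)
    by_cases hx : x i = b
    · subst hx
      simpa [mul_assoc] using this
    · have hb : (!x i) = b := by
        cases b <;> cases hxi : x i <;> simp_all
      simp [hx, hb]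
  linarith

lemma logLipschitz.sum_half_pow_le {n : ℕ} {α : ℝ} (hα : 1 ≤ α)
    {μ : Measure (Fin n → Bool)} [IsProbabilityMeasure μ] (h : logLipschitz n α μ)
    (I : Finset (Fin n)) :
    ∑ x, μ.real {x} * (1 / 2 : ℝ) ^ (I.filter fun i => x i = false).card ≤
      (1 - 1 / (2 * (1 + α))) ^ I.card := by
  induction I using Finset.induction_on with
  | empty =>
    simp
  | insert i I hi ih =>
    set g : (Fin n → Bool) → ℝ := fun x => (1 / 2 : ℝ) ^ (I.filter fun i => x i = false).card
      with hgdef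
    have hgi : ∀ x, g (flipBit i x) = g x := by
      intro x
      simp only [hgdef]
      congr 2
      refine Finset.filter_congr fun j hj => ?_
      rw [flipBit_apply_of_ne (ne_of_mem_of_not_mem hj hi)]
    have key := h.sum_le_sum_ite hα i false g (fun x => by positivity) hgi
    have eq : ∑ x, μ.real {x} * (1 / 2 : ℝ) ^ ((insert i I).filter fun i => x i = false).card =
        ∑ x, μ.real {x} * g x - 1 / 2 * ∑ x, if x i = false then μ.real {x} * g x else 0 := by
      rw [Finset.mul_sum, ← Finset.sum_sub_distrib]
      refine Finset.sum_congr rfl fun x _ => ?_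
      by_cases hx : x i = false
      · simp only [Finset.filter_insert, hx, if_true, hgdef]
        rw [Finset.card_insert_of_notMem (by simp [hi]), pow_succ]
        ring
      · rw [if_neg hx, Finset.filter_insert, if_neg hx, mul_zero, sub_zero]
    rw [eq, Finset.card_insert_of_notMem hi, pow_succ]
    have hα0 : 0 < 1 + α := by linarith
    have hη : 0 ≤ 1 - 1 / (2 * (1 + α)) := by
      rw [sub_nonneg, div_le_one (by linarith)]
      linarith
    refine le_trans ?_ (mul_le_mul_of_nonneg_right ih hη)
    rw [← div_le_iff₀' hα0] at key
    have : (1 / (2 * (1 + α))) * ∑ x, μ.real {x} * g x =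
        1 / 2 * ((∑ x, μ.real {x} * g x) / (1 + α)) := by
      field_simp
    nlinarith

lemma measureReal_eq_sum_ite {n : ℕ} (μ : Measure (Fin n → Bool)) [IsProbabilityMeasure μ]
    (p : (Fin n → Bool) → Prop) [DecidablePred p] :
    μ.real {x | p x} = ∑ x, if p x then μ.real {x} else 0 := by
  rw [← Finset.sum_filter, sum_measureReal_singleton]
  simp

/-- Lower tail bound on the number of zeros among the coordinates in `I`. -/
lemma logLipschitz.measureReal_card_le {n : ℕ} {α : ℝ} (hα : 1 ≤ α)
    {μ : Measure (Fin n → Bool)} [IsProbabilityMeasure μ] (h : logLipschitz n α μ)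
    (I : Finset (Fin n)) (ρ : ℕ) :
    μ.real {x | (I.filter fun i => x i = false).card ≤ ρ} ≤
      2 ^ ρ * (1 - 1 / (2 * (1 + α))) ^ I.card := by
  rw [measureReal_eq_sum_ite]
  refine le_trans ?_ (mul_le_mul_of_nonneg_left (h.sum_half_pow_le hα I) (by positivity))
  rw [Finset.mul_sum]
  refine Finset.sum_le_sum fun x _ => ?_
  split_ifs with hx
  · have h1 : (1 : ℝ) ≤ 2 ^ ρ * (1 / 2 : ℝ) ^ (I.filter fun i => x i = false).card := by
      calc (1 : ℝ) = 2 ^ ρ * (1 / 2 : ℝ) ^ ρ := by rw [← mul_pow]; norm_num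
        _ ≤ _ := mul_le_mul_of_nonneg_left
          (pow_le_pow_of_le_one (by norm_num) (by norm_num) hx) (by positivity)
    have h2 := mul_le_mul_of_nonneg_left h1 (measureReal_nonneg (μ := μ) (s := {x}))
    linarith
  · positivity

lemma logLipschitz.one_le_measureReal_forall_true {n : ℕ} {α : ℝ} (hα : 1 ≤ α)
    {μ : Measure (Fin n → Bool)} [IsProbabilityMeasure μ] (h : logLipschitz n α μ)
    (I : Finset (Fin n)) :
    1 ≤ (1 + α) ^ I.card * ∑ x, μ.real {x} * if ∀ i ∈ I, x i = true then 1 else 0 := by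
  induction I using Finset.induction_on with
  | empty => simp
  | insert i I hi ih =>
    have key := h.sum_le_sum_ite hα i true (fun x => if ∀ i ∈ I, x i = true then 1 else 0)
      (fun x => by split_ifs <;> simp) (fun x => by
        refine if_congr (forall₂_congr fun j hj => ?_) rfl rfl
        rw [flipBit_apply_of_ne (ne_of_mem_of_not_mem hj hi)])
    have hα0 : 0 < 1 + α := by linarith
    refine ih.trans ?_
    rw [Finset.card_insert_of_notMem hi, pow_succ, mul_assoc]
    refine mul_le_mul_of_nonneg_left (key.trans_eq ?_) (by positivity)
    congr 1
    refine Finset.sum_congr rfl fun x _ => ?_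
    by_cases hx : x i = true <;> simp [hx]

lemma logLipschitz.one_le_measureReal_witness {n : ℕ} {α : ℝ} (hα : 1 ≤ α)
    {μ : Measure (Fin n → Bool)} [IsProbabilityMeasure μ] (h : logLipschitz n α μ)
    (I : Finset (Fin n)) (i : Fin n) (hi : i ∉ I) :
    1 ≤ (1 + α) ^ (I.card + 1) * μ.real {x | (∀ j ∈ I, x j = true) ∧ x i = false} := by
  have key := h.sum_le_sum_ite hα i false (fun x => if ∀ i ∈ I, x i = true then 1 else 0)
    (fun x => by split_ifs <;> simp) (fun x => by
      refine if_congr (forall₂_congr fun j hj => ?_) rfl rfl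
      rw [flipBit_apply_of_ne (ne_of_mem_of_not_mem hj hi)])
  have hα0 : 0 < 1 + α := by linarith
  refine (h.one_le_measureReal_forall_true hα I).trans ?_
  rw [pow_succ, mul_assoc]
  refine mul_le_mul_of_nonneg_left (key.trans_eq ?_) (by positivity)
  rw [measureReal_eq_sum_ite]
  congr 1
  refine Finset.sum_congr rfl fun x _ => ?_
  by_cases hx : x i = false <;> simp [hx]

/-- Indices that are `1` in every positive example. -/
def survivingIndices (n m : ℕ) (S : Fin m → (Fin n → Bool) × Bool) : Finset (Fin n) :=
  Finset.univ.filter fun i => ∀ j, (S j).2 = true → (S j).1 i = true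

lemma subset_survivingIndices {n m : ℕ} (I : Finset (Fin n)) (S : Fin m → (Fin n → Bool)) :
    I ⊆ survivingIndices n m (labelWith n (monConj n I) S) := by
  intro i hi
  simp only [survivingIndices, labelWith, monConj, Finset.mem_filter, Finset.mem_univ, true_and,
    decide_eq_true_eq]
  exact fun j hj => hj i hi

lemma survivingIndices_eq {n m : ℕ} (I : Finset (Fin n)) (S : Fin m → (Fin n → Bool))
    (h : ∀ i ∉ I, ∃ j, (∀ k ∈ I, S j k = true) ∧ S j i = false) :
    survivingIndices n m (labelWith n (monConj n I) S) = I := by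
  refine (Finset.Subset.antisymm (subset_survivingIndices I S) fun i hi => ?_).symm
  by_contra hiI
  obtain ⟨j, hj, hji⟩ := h i hiI
  simp only [survivingIndices, labelWith, monConj, Finset.mem_filter, Finset.mem_univ, true_and,
    decide_eq_true_eq] at hi
  simp [hi j hj] at hji

lemma RE_self (n ρ : ℕ) (μ : Measure (Fin n → Bool)) (c : (Fin n → Bool) → Bool) :
    RE n ρ μ c c = 0 := by
  simp [RE]

/-- A conjunction with more indices errs only on points where the target is positive. -/
lemma RE_monConj_le {n : ℕ} (ρ : ℕ) (μ : Measure (Fin n → Bool)) {I J : Finset (Fin n)}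
    (hIJ : I ⊆ J) :
    RE n ρ μ (monConj n J) (monConj n I) ≤
      μ {x | (I.filter fun i => x i = false).card ≤ ρ} := by
  refine measure_mono ?_
  rintro x ⟨z, hz, hne⟩
  have hpos : ∀ i ∈ I, z i = true := by
    by_contra hI
    have hJ : ¬ ∀ i ∈ J, z i = true := fun hJ => hI fun i hi => hJ i (hIJ hi)
    simp [monConj, hI, hJ] at hne
  refine le_trans (Finset.card_le_card fun i hi => ?_) hz
  simp only [Finset.mem_filter, Finset.mem_univ, true_and] at hi ⊢
  simp [hi.2, hpos i hi.1]

lemma one_sub_pow_le_inv_mul {p : ℝ} (hp : 0 < p) (hp1 : p ≤ 1) {m : ℕ} (hm : 0 < m) :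
    (1 - p) ^ m ≤ 1 / (m * p) := by
  have hm' : (0 : ℝ) < m := by exact_mod_cast hm
  have h1 : (1 - p) ^ m ≤ Real.exp (-(m * p)) := by
    rw [← mul_neg, Real.exp_nat_mul]
    exact pow_le_pow_left₀ (by linarith) (by linarith [Real.add_one_le_exp (-p)]) m
  refine h1.trans ?_
  rw [Real.exp_neg, ← one_div]
  exact one_div_le_one_div_of_le (by positivity) (by linarith [Real.add_one_le_exp (m * p)])

lemma pi_measure_exists_not_mem_le {n m : ℕ} (μ : Measure (Fin n → Bool)) [IsProbabilityMeasure μ]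
    (E : Fin n → Set (Fin n → Bool)) (T : Finset (Fin n)) {q : ℝ} (hq : 0 < q)
    (hE : ∀ i ∈ T, 1 ≤ q * μ.real (E i)) (hm : 0 < m) :
    (Measure.pi fun _ : Fin m => μ) {S | ∃ i ∈ T, ∀ j, S j ∉ E i} ≤
      ENNReal.ofReal (n * (q / m)) := by
  have hset : {S : Fin m → (Fin n → Bool) | ∃ i ∈ T, ∀ j, S j ∉ E i} =
      ⋃ i ∈ T, Set.univ.pi fun _ => (E i)ᶜ := by
    ext S
    simp
  have hm' : (0 : ℝ) < m := by exact_mod_cast hm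
  rw [hset]
  refine (measure_biUnion_finset_le _ _).trans ?_
  have hb : ∀ i ∈ T, (Measure.pi fun _ : Fin m => μ) (Set.univ.pi fun _ => (E i)ᶜ) ≤
      ENNReal.ofReal (q / m) := by
    intro i hi
    have hp : 0 < μ.real (E i) := by
      by_contra hp
      have := hE i hi
      nlinarith
    rw [Measure.pi_pi, Finset.prod_const, Finset.card_univ, Fintype.card_fin,
      ← ofReal_measureReal, ← ENNReal.ofReal_pow measureReal_nonneg,
      probReal_compl_eq_one_sub (Set.toFinite _).measurableSet]
    refine ENNReal.ofReal_le_ofReal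
      ((one_sub_pow_le_inv_mul hp measureReal_le_one hm).trans ?_)
    rw [div_le_div_iff₀ (by positivity) hm']
    nlinarith [hE i hi]
  refine (Finset.sum_le_sum hb).trans ?_
  rw [Finset.sum_const, nsmul_eq_mul, ENNReal.ofReal_mul (by positivity), ENNReal.ofReal_natCast]
  gcongr
  exact (Finset.card_le_univ T).trans_eq (Fintype.card_fin n)

/-- Sample size bound for a fixed, not too large, target. -/
lemma logLipschitz.one_sub_le_pi_of_card {n m : ℕ} {α : ℝ} (hα : 1 ≤ α)
    {μ : Measure (Fin n → Bool)} [IsProbabilityMeasure μ] (h : logLipschitz n α μ)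
    (I : Finset (Fin n)) {δ : ℝ} (hm : 0 < m)
    (hmδ : n * (1 + α) ^ (I.card + 1) ≤ m * δ) :
    1 - ENNReal.ofReal δ ≤ (Measure.pi fun _ : Fin m => μ)
      {S | survivingIndices n m (labelWith n (monConj n I) S) = I} := by
  have hm' : (0 : ℝ) < m := by exact_mod_cast hm
  have hbad := pi_measure_exists_not_mem_le (m := m) μ
    (fun i => {x | (∀ j ∈ I, x j = true) ∧ x i = false}) Iᶜ
    (q := (1 + α) ^ (I.card + 1)) (by positivity)
    (fun i hi => h.one_le_measureReal_witness hα I i (by simpa using hi)) hm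
  have hle : (n : ℝ) * ((1 + α) ^ (I.card + 1) / m) ≤ δ := by
    rw [← mul_div_assoc, div_le_iff₀ hm']
    linarith
  replace hbad := hbad.trans (ENNReal.ofReal_le_ofReal hle)
  refine (tsub_le_tsub_left hbad 1).trans ?_
  rw [← prob_compl_eq_one_sub (Set.toFinite _).measurableSet]
  refine measure_mono fun S hS => survivingIndices_eq I S fun i hi => ?_
  by_contra hne
  refine hS ⟨i, by simpa using hi, fun j hj => hne ⟨j, hj⟩⟩

lemma two_pow_le_natCast_pow {C : ℝ} {n ρ : ℕ} (hn : 0 < n)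
    (hρ : (ρ : ℝ) ≤ C * Real.log n) : (2 : ℝ) ^ ρ ≤ (n : ℝ) ^ ⌈C⌉₊ := by
  have hn' : (0 : ℝ) < n := by exact_mod_cast hn
  have hlog : 0 ≤ Real.log n := Real.log_natCast_nonneg n
  have he : (2 : ℝ) ≤ Real.exp 1 := by linarith [Real.add_one_le_exp (1 : ℝ)]
  calc (2 : ℝ) ^ ρ ≤ Real.exp 1 ^ ρ := pow_le_pow_left₀ (by norm_num) he ρ
    _ = Real.exp ρ := by rw [← Real.exp_nat_mul, mul_one]
    _ ≤ Real.exp (⌈C⌉₊ * Real.log n) :=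
      Real.exp_le_exp.2 (hρ.trans (mul_le_mul_of_nonneg_right (Nat.le_ceil C) hlog))
    _ = (n : ℝ) ^ ⌈C⌉₊ := by rw [Real.exp_nat_mul, Real.exp_log hn']

/-- monotone conjunctions are `ρ`-robustly learnable with
polynomial sample complexity with respect to `α`-log-Lipschitz distributions,
for any robustness bound `ρ ≤ C·log n`. -/
theorem stmt11 (α C : ℝ) (hα : 1 ≤ α) (hC : 0 < C) :
    ∃ (A : ∀ n m : ℕ, (Fin m → (Fin n → Bool) × Bool) → ((Fin n → Bool) → Bool))
      (K : ℝ) (k : ℕ),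
      ∀ (n : ℕ) (μ : Measure (Fin n → Bool)), IsProbabilityMeasure μ →
        logLipschitz n α μ →
        ∀ (I : Finset (Fin n)) (ε δ : ℝ), 0 < ε → ε < 1 → 0 < δ → δ < 1 →
          ∀ ρ : ℕ, (ρ : ℝ) ≤ C * Real.log n →
            ∀ m : ℕ, K * ((n : ℝ) * (1 / ε) * (1 / δ)) ^ k ≤ (m : ℝ) →
              (Measure.pi fun _ : Fin m => μ)
                  {S : Fin m → (Fin n → Bool) |
                    RE n ρ μ (A n m (labelWith n (monConj n I) S)) (monConj n I)
                      ≤ ENNReal.ofReal ε}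
                ≥ 1 - ENNReal.ofReal δ := by
  set η : ℝ := 1 - 1 / (2 * (1 + α)) with hη
  have hinv : 1 / (2 * (1 + α)) ≤ 1 / 2 :=
    one_div_le_one_div_of_le (by norm_num) (by linarith)
  have hinv0 : 0 < 1 / (2 * (1 + α)) := by positivity
  have hη0 : 0 < η := by linarith
  have hη1 : η < 1 := by linarith
  obtain ⟨s, hs⟩ := pow_unbounded_of_one_lt (1 + α) ((one_lt_inv₀ hη0).2 hη1)
  refine ⟨fun n m S => monConj n (survivingIndices n m S), 1 + α, (⌈C⌉₊ + 1) * s + 1, ?_⟩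
  intro n μ hμ hL I ε δ hε0 hε1 hδ0 hδ1 ρ hρ m hm
  rcases Nat.eq_zero_or_pos n with rfl | hn
  · simp [Subsingleton.elim (survivingIndices 0 m _) I, RE_self]
  by_cases hlarge : 2 ^ ρ * η ^ I.card ≤ ε
  · have huniv : {S : Fin m → (Fin n → Bool) |
        RE n ρ μ (monConj n (survivingIndices n m (labelWith n (monConj n I) S))) (monConj n I)
          ≤ ENNReal.ofReal ε} = Set.univ := by
      refine Set.eq_univ_of_forall fun S => ?_
      refine (RE_monConj_le ρ μ (subset_survivingIndices I S)).trans ?_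
      rw [← ofReal_measureReal]
      exact ENNReal.ofReal_le_ofReal ((hL.measureReal_card_le hα I ρ).trans hlarge)
    rw [huniv, measure_univ]
    exact tsub_le_self
  · push Not at hlarge
    set X : ℝ := (n : ℝ) * (1 / ε) * (1 / δ) with hX
    have hn1 : (1 : ℝ) ≤ n := by exact_mod_cast hn
    have hε : 1 ≤ 1 / ε := by rw [le_div_iff₀ hε0]; linarith
    have hδ : 1 ≤ 1 / δ := by rw [le_div_iff₀ hδ0]; linarith
    have hεX : 1 / ε ≤ X := by
      rw [hX]
      nlinarith [mul_le_mul hn1 (le_refl (1 / ε)) (by linarith) (by linarith)]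
    have hnX : (n : ℝ) / δ ≤ X := by
      rw [hX, mul_right_comm, mul_one_div (n : ℝ) δ]
      exact le_mul_of_one_le_right (by positivity) hε
    have hnX' : (n : ℝ) ≤ X := by
      refine le_trans ?_ hnX
      rw [← mul_one_div]
      exact le_mul_of_one_le_right (by positivity) hδ
    have hX1 : 1 ≤ X := hn1.trans hnX'
    have hcard : (1 + α) ^ I.card ≤ X ^ ((⌈C⌉₊ + 1) * s) := by
      calc (1 + α) ^ I.card ≤ (η⁻¹ ^ s) ^ I.card := pow_le_pow_left₀ (by linarith) hs.le _
        _ = (η⁻¹ ^ I.card) ^ s := by rw [← pow_mul, ← pow_mul, mul_comm]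
        _ ≤ (2 ^ ρ * (1 / ε)) ^ s := by
          refine pow_le_pow_left₀ (by positivity) ?_ s
          rw [inv_pow, mul_one_div, le_div_iff₀ hε0, inv_mul_le_iff₀ (by positivity)]
          linarith
        _ ≤ (X ^ ⌈C⌉₊ * X) ^ s := by
          refine pow_le_pow_left₀ (by positivity) ?_ s
          refine mul_le_mul ?_ hεX (by positivity) (by positivity)
          exact (two_pow_le_natCast_pow hn hρ).trans (pow_le_pow_left₀ (by positivity) hnX' _)
        _ = _ := by rw [← pow_succ, pow_mul]
    have hm0 : 0 < m := by
      have : (0 : ℝ) < m := lt_of_lt_of_le (by positivity) hm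
      exact_mod_cast this
    refine (hL.one_sub_le_pi_of_card (m := m) hα I hm0 ?_).trans ?_
    · rw [← div_le_iff₀ hδ0]
      refine le_trans ?_ hm
      calc (n : ℝ) * (1 + α) ^ (I.card + 1) / δ
          = (1 + α) * ((1 + α) ^ I.card * (n / δ)) := by rw [pow_succ]; ring
        _ ≤ (1 + α) * (X ^ ((⌈C⌉₊ + 1) * s) * X) := by gcongr
        _ = _ := by rw [← pow_succ]
    · refine measure_mono fun S hS => ?_
      simp only [Set.mem_ofPred_eq] at hS ⊢
      rw [hS, RE_self]
      exact zero_le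
end

section
/- Let n, k ∈ ℕ with k ≥ 1, let D be a probability distribution on {0,1}^n, and let c : {0,1}^n → {0,1}. Define φ_k : {0,1}^n → {0,1}^{(2k+1)n+1} by φ_k(x) = rep_k(x)·c(x) (the repetition encoding of x followed by the bit c(x)), let D' be the pushforward of D under φ_k, and let c' : {0,1}^{(2k+1)n+1} → {0,1} be c'(z) = c(maj_k(z₁…z_{(2k+1)n})) (ignoring the last bit). For any h : {0,1}^n → {0,1}, define h'(z) = h(maj_k(z₁…z_{(2k+1)n})). Then the k-robust risks of h' with respect to c' under D' both equal the standard risk of h: R^C_k(h', c') = R^E_k(h', c') = Pr_{x∼D}[h(x) ≠ c(x)]. -/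
open MeasureTheory ENNReal Filter

/-- Repetition code: `2k+1` consecutive copies of each bit. -/
def rep (n k : ℕ) (x : Fin n → Bool) : Fin ((2*k+1)*n) → Bool :=
  fun j => x ⟨j.val / (2*k+1), Nat.div_lt_of_lt_mul j.isLt⟩

/-- Blockwise majority decoding: the `i`-th output bit is the majority value of
the `i`-th block of `2k+1` bits. -/
def maj (n k : ℕ) (z : Fin ((2*k+1)*n) → Bool) : Fin n → Bool :=
  fun i => decide (k + 1 ≤ (Finset.univ.filter
    (fun j : Fin ((2*k+1)*n) => j.val / (2*k+1) = i.val ∧ z j = true)).card)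

/-- `φ_k(x) = rep_k(x) · c(x)`: repetition encoding followed by the label bit. -/
def phi (n k : ℕ) (c : (Fin n → Bool) → Bool) (x : Fin n → Bool) :
    Fin ((2*k+1)*n+1) → Bool :=
  fun j => if h : j.val < (2*k+1)*n then rep n k x ⟨j.val, h⟩ else c x

/-- Drop the last bit of a string in `{0,1}^{(2k+1)n+1}`. -/
def trunc (n k : ℕ) (z : Fin ((2*k+1)*n+1) → Bool) : Fin ((2*k+1)*n) → Bool :=
  fun j => z ⟨j.val, Nat.lt_succ_of_lt j.isLt⟩

theorem card_block (n k : ℕ) (i : Fin n) :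
    (Finset.univ.filter
      (fun j : Fin ((2*k+1)*n) => j.val / (2*k+1) = i.val)).card = 2*k+1 := by
  have hi : (2*k+1) * (i.val + 1) ≤ (2*k+1) * n := Nat.mul_le_mul_left _ i.isLt
  rw [Nat.mul_succ] at hi
  have hcard : (Finset.univ : Finset (Fin (2*k+1))).card = 2*k+1 := by simp
  refine Eq.trans (Eq.symm ?_) hcard
  refine Finset.card_bij (fun r _ => ⟨(2*k+1) * i.val + r.val, by omega⟩) ?_ ?_ ?_
  · intro r _
    simp [Nat.mul_add_div, Nat.div_eq_of_lt r.isLt]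
  · intro r _ s _ hrs
    simpa [Fin.ext_iff] using hrs
  · intro j hj
    have hj' : j.val / (2*k+1) = i.val := by simpa using hj
    refine ⟨⟨j.val % (2*k+1), Nat.mod_lt _ (by omega)⟩, Finset.mem_univ _, ?_⟩
    ext
    simp only [← hj']
    exact Nat.div_add_mod _ _

theorem maj_eq_of_hammingDist_rep_le (n k : ℕ) (x : Fin n → Bool)
    (z : Fin ((2*k+1)*n) → Bool) (hz : hammingDist (rep n k x) z ≤ k) :
    maj n k z = x := by
  funext i
  have hsplit := Finset.card_filter_add_card_filter_not (s := Finset.univ.filter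
    (fun j : Fin ((2*k+1)*n) => j.val / (2*k+1) = i.val)) (fun j => z j = true)
  rw [card_block, Finset.filter_filter, Finset.filter_filter] at hsplit
  have hrep : ∀ j : Fin ((2*k+1)*n), j.val / (2*k+1) = i.val → rep n k x j = x i := by
    intro j hj
    exact congrArg x (Fin.ext hj)
  unfold hammingDist at hz
  cases hx : x i
  · have hle : (Finset.univ.filter (fun j : Fin ((2*k+1)*n) =>
        j.val / (2*k+1) = i.val ∧ z j = true)).card ≤ k := by
      refine (Finset.card_le_card fun j hj => ?_).trans hz
      simp only [Finset.mem_filter, Finset.mem_univ, true_and] at hj ⊢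
      simp [hrep j hj.1, hx, hj.2]
    exact decide_eq_false (by omega)
  · have hle : (Finset.univ.filter (fun j : Fin ((2*k+1)*n) =>
        j.val / (2*k+1) = i.val ∧ ¬ z j = true)).card ≤ k := by
      refine (Finset.card_le_card fun j hj => ?_).trans hz
      simp only [Finset.mem_filter, Finset.mem_univ, true_and] at hj ⊢
      simpa [hrep j hj.1, hx] using hj.2
    exact decide_eq_true (by omega)

theorem trunc_phi (n k : ℕ) (c : (Fin n → Bool) → Bool) (x : Fin n → Bool) :
    trunc n k (phi n k c x) = rep n k x := by
  funext j
  simp [trunc, phi]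

theorem hammingDist_trunc_le (n k : ℕ) (y z : Fin ((2*k+1)*n+1) → Bool) :
    hammingDist (trunc n k y) (trunc n k z) ≤ hammingDist y z := by
  refine Finset.card_le_card_of_injOn Fin.castSucc (fun j hj => ?_)
    (Fin.castSucc_injective _).injOn
  simp only [SetLike.mem_coe, Finset.mem_filter, Finset.mem_univ, true_and] at hj ⊢
  exact hj

theorem maj_trunc_of_hammingDist_phi_le (n k : ℕ) (c : (Fin n → Bool) → Bool)
    (x : Fin n → Bool) (z : Fin ((2*k+1)*n+1) → Bool)
    (hz : hammingDist (phi n k c x) z ≤ k) : maj n k (trunc n k z) = x :=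
  maj_eq_of_hammingDist_rep_le n k x _ <|
    trunc_phi n k c x ▸ (hammingDist_trunc_le n k _ z).trans hz

/-- for the encoded concept `c' = c ∘ maj_k` and the pushforward
distribution `D' = φ_k(D)`, both `k`-robust risks of `h' = h ∘ maj_k` with
respect to `c'` equal the standard risk of `h` with respect to `c` under `D`. -/
theorem stmt18 (n k : ℕ) (hk : 1 ≤ k) (μ : Measure (Fin n → Bool))
    [IsProbabilityMeasure μ] (c h : (Fin n → Bool) → Bool) :
    RC ((2*k+1)*n+1) k (Measure.map (phi n k c) μ)
        (fun z => h (maj n k (trunc n k z))) (fun z => c (maj n k (trunc n k z)))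
      = μ {x | h x ≠ c x} ∧
    RE ((2*k+1)*n+1) k (Measure.map (phi n k c) μ)
        (fun z => h (maj n k (trunc n k z))) (fun z => c (maj n k (trunc n k z)))
      = μ {x | h x ≠ c x} := by
  have hself : ∀ x, hammingDist (phi n k c x) (phi n k c x) ≤ k := by simp
  have hdec := maj_trunc_of_hammingDist_phi_le n k c
  constructor
  · rw [RC, Measure.map_apply (measurable_of_countable _) (Set.toFinite _).measurableSet]
    congr 1
    ext x
    simp only [Set.mem_preimage, Set.mem_ofPred_eq, hdec x _ (hself x)]
    constructor
    · rintro ⟨z, hz, hne⟩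
      rwa [hdec x z hz] at hne
    · intro hne
      exact ⟨_, hself x, by rwa [hdec x _ (hself x)]⟩
  · rw [RE, Measure.map_apply (measurable_of_countable _) (Set.toFinite _).measurableSet]
    congr 1
    ext x
    simp only [Set.mem_preimage, Set.mem_ofPred_eq]
    constructor
    · rintro ⟨z, hz, hne⟩
      rwa [hdec x z hz] at hne
    · intro hne
      exact ⟨_, hself x, by rwa [hdec x _ (hself x)]⟩
end

section
/- Let n, k ∈ ℕ with k ≥ 1, let D be a probability distribution on {0,1}^n, and let c : {0,1}^n → {0,1}. Define φ_k(x) = rep_k(x)·c(x) ∈ {0,1}^{(2k+1)n+1}, let D' be the pushforward of D under φ_k, let c'(z) = c(maj_k(z₁…z_{(2k+1)n})), and let ψ(x) = rep_k(x)·0 (repetition encoding with last bit 0). Then for every hypothesis h' : {0,1}^{(2k+1)n+1} → {0,1} and every ε ≥ 0: if R^C_k(h', c') ≤ ε under D', then Pr_{x∼D}[h'(ψ(x)) ≠ c(x)] ≤ ε; and the same conclusion holds if instead R^E_k(h', c') ≤ ε under D'. In other words, any k-robust learner for the encoded concept yields a PAC learner (via h = h'∘ψ) for the original concept with the same error. 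-/
open MeasureTheory ENNReal Filter

/-- `ψ(x) = rep_k(x) · 0`: repetition encoding with the last bit set to `0`. -/
def psi (n k : ℕ) (x : Fin n → Bool) : Fin ((2*k+1)*n+1) → Bool :=
  fun j => if h : j.val < (2*k+1)*n then rep n k x ⟨j.val, h⟩ else false

theorem maj_rep (n k : ℕ) (x : Fin n → Bool) : maj n k (rep n k x) = x := by
  funext i
  unfold maj
  cases hx : x i
  · have hempty : Finset.univ.filter (fun j : Fin ((2*k+1)*n) =>
        j.val / (2*k+1) = i.val ∧ rep n k x j = true) = ∅ := by
      refine Finset.filter_eq_empty_iff.2 ?_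
      rintro j - ⟨hj, hxj⟩
      have hji : (⟨j.val / (2*k+1), Nat.div_lt_of_lt_mul j.isLt⟩ : Fin n) = i := Fin.ext hj
      simp [rep, hji, hx] at hxj
    simp [hempty]
  · have hlt (a : Fin (2*k+1)) : (2*k+1) * i.val + a.val < (2*k+1) * n :=
      calc (2*k+1) * i.val + a.val < (2*k+1) * (i.val + 1) := by rw [mul_add]; omega
        _ ≤ (2*k+1) * n := Nat.mul_le_mul_left _ i.isLt
    have hcard : (Finset.univ : Finset (Fin (2*k+1))).card ≤ (Finset.univ.filter
        (fun j : Fin ((2*k+1)*n) => j.val / (2*k+1) = i.val ∧ rep n k x j = true)).card := by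
      refine Finset.card_le_card_of_injOn (fun a => ⟨_, hlt a⟩) ?_ ?_
      · intro a _
        have hdiv : ((2*k+1) * i.val + a.val) / (2*k+1) = i.val := by
          rw [Nat.mul_add_div (by omega), Nat.div_eq_of_lt a.isLt, add_zero]
        refine Finset.mem_coe.2 (Finset.mem_filter.2 ⟨Finset.mem_univ _, hdiv, ?_⟩)
        simp only [rep, hdiv, Fin.eta, hx]
      · intro a _ b _ hab
        have := congrArg Fin.val hab
        exact Fin.ext (by simpa using this)
    rw [Finset.card_univ, Fintype.card_fin] at hcard
    exact decide_eq_true (by omega)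

theorem trunc_psi (n k : ℕ) (x : Fin n → Bool) : trunc n k (psi n k x) = rep n k x := by
  funext j
  simp [trunc, psi]

theorem hammingDist_phi_psi_le_one (n k : ℕ) (c : (Fin n → Bool) → Bool) (x : Fin n → Bool) :
    hammingDist (phi n k c x) (psi n k x) ≤ 1 := by
  have hlast : ∀ j, phi n k c x j ≠ psi n k x j → j = Fin.last _ := by
    intro j hj
    by_contra hne
    have hlt : j.val < (2*k+1)*n := Fin.val_lt_last hne
    exact hj (by simp [phi, psi, hlt])
  refine Finset.card_le_one.2 fun a ha b hb => ?_
  rw [hlast a (Finset.mem_filter.1 ha).2, hlast b (Finset.mem_filter.1 hb).2]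

/-- any hypothesis `h'` with `k`-robust risk `≤ ε` (in either
sense) with respect to the encoded concept `c' = c ∘ maj_k` under the
pushforward distribution `D' = φ_k(D)` yields, via `h = h' ∘ ψ`, a hypothesis
with standard risk `≤ ε` for `c` under `D`. -/
theorem stmt19 (n k : ℕ) (hk : 1 ≤ k) (μ : Measure (Fin n → Bool))
    [IsProbabilityMeasure μ] (c : (Fin n → Bool) → Bool)
    (h' : (Fin ((2*k+1)*n+1) → Bool) → Bool) (ε : ℝ≥0∞) :
    (RC ((2*k+1)*n+1) k (Measure.map (phi n k c) μ) h'
        (fun z => c (maj n k (trunc n k z))) ≤ ε →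
      μ {x | h' (psi n k x) ≠ c x} ≤ ε) ∧
    (RE ((2*k+1)*n+1) k (Measure.map (phi n k c) μ) h'
        (fun z => c (maj n k (trunc n k z))) ≤ ε →
      μ {x | h' (psi n k x) ≠ c x} ≤ ε) := by
  have hmap (s : Set (Fin ((2*k+1)*n+1) → Bool)) :
      Measure.map (phi n k c) μ s = μ (phi n k c ⁻¹' s) :=
    Measure.map_apply (measurable_of_finite _) s.toFinite.measurableSet
  have hdist (x : Fin n → Bool) : hammingDist (phi n k c x) (psi n k x) ≤ k :=
    (hammingDist_phi_psi_le_one n k c x).trans hk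
  constructor
  · intro hε
    rw [RC, hmap] at hε
    refine le_trans (measure_mono fun x hx => ?_) hε
    refine ⟨psi n k x, hdist x, ?_⟩
    simpa only [trunc_phi, maj_rep, Set.mem_ofPred_eq] using hx
  · intro hε
    rw [RE, hmap] at hε
    refine le_trans (measure_mono fun x hx => ?_) hε
    refine ⟨psi n k x, hdist x, ?_⟩
    simpa only [trunc_psi, maj_rep, Set.mem_ofPred_eq] using hx
end
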